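/- arXiv:math/0107049 — 4 statements merged into one kernel-verified Lean document; each statement's English description precedes it below -/
import Mathlib

section
/- Free groups have the algebraic eigenvalue property: if F is a free group (on an arbitrary set of generators), d ≥ 1, and A ∈ M_d(ℚ̄F), then every eigenvalue of A acting on ℓ²(F;ℂ^d) — i.e. every λ ∈ ℂ for which there exists a nonzero f ∈ ℓ²(F;ℂ^d) with Af = λf — is algebraic over ℚ. -/
set_option synthInstance.maxHeartbeats 1000000
set_option maxHeartbeats 1000000

noncomputable section

abbrev L2 (I : Type*) (d : ℕ) : Type _ := lp (fun _ : I × Fin d => ℂ) 2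

/-- `T` is the bounded operator on `ℓ²(G; ℂ^d)` given by (left convolution by) the matrix
`A = ∑_g A_g g ∈ M_d(ℂG)`: `(Af)(x) = ∑_g A_g f(g⁻¹x)`. -/
def Represents {G : Type*} [Group G] {d : ℕ} (A : G →₀ Matrix (Fin d) (Fin d) ℂ)
    (T : L2 G d →L[ℂ] L2 G d) : Prop :=
  ∀ (f : L2 G d) (x : G) (i : Fin d),
    T f (x, i) = ∑ g ∈ A.support, ∑ j : Fin d, A g i j * f (g⁻¹ * x, j)

/-- `G` has the algebraic eigenvalue property: every eigenvalue of a square matrix over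
`ℚ̄G` (modelled as a matrix over `ℂG` with algebraic entries) acting on `ℓ²(G; ℂ^d)` is an
algebraic number. -/
def HasAlgebraicEigenvalueProperty (G : Type*) [Group G] : Prop :=
  ∀ (d : ℕ), 1 ≤ d → ∀ A : G →₀ Matrix (Fin d) (Fin d) ℂ,
    (∀ (g : G) (i j : Fin d), IsAlgebraic ℚ (A g i j)) →
    ∀ T : L2 G d →L[ℂ] L2 G d, Represents A T →
    ∀ (lam : ℂ) (f : L2 G d), f ≠ 0 → T f = lam • f → IsAlgebraic ℚ lam

/-- `G` has the algebraic eigenvalue property for rational matrices. -/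
def HasRationalAlgebraicEigenvalueProperty (G : Type*) [Group G] : Prop :=
  ∀ (d : ℕ), 1 ≤ d → ∀ A : G →₀ Matrix (Fin d) (Fin d) ℂ,
    (∀ (g : G) (i j : Fin d), ∃ q : ℚ, A g i j = (q : ℂ)) →
    ∀ T : L2 G d →L[ℂ] L2 G d, Represents A T →
    ∀ (lam : ℂ) (f : L2 G d), f ≠ 0 → T f = lam • f → IsAlgebraic ℚ lam

end


namespace FreeEig

abbrev HH (P : Type*) : Type _ := lp (fun _ : P => ℂ) 2

/-- Evaluation at a point. -/
noncomputable def evp {P : Type*} (p : P) : HH P →L[ℂ] ℂ :=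
  LinearMap.mkContinuous
    { toFun := fun f => f p
      map_add' := fun _ _ => rfl
      map_smul' := fun _ _ => rfl } 1
    (fun f => by
      rw [one_mul]
      exact lp.norm_apply_le_norm (by norm_num) f p)

@[simp] theorem evp_apply {P : Type*} (p : P) (f : HH P) : evp p f = f p := rfl

/-- Norm of the evaluation functional on a subspace. -/
noncomputable def tau {P : Type*} (L : Submodule ℂ (HH P)) (p : P) : ℝ :=
  ‖(evp p).comp L.subtypeL‖

theorem tau_nonneg {P : Type*} (L : Submodule ℂ (HH P)) (p : P) : 0 ≤ tau L p := by
  unfold tau; positivity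

theorem norm_le_tau {P : Type*} (L : Submodule ℂ (HH P)) (p : P) (f : HH P) (hf : f ∈ L) :
    ‖f p‖ ≤ tau L p * ‖f‖ :=
  ((evp p).comp L.subtypeL).le_opNorm ⟨f, hf⟩

theorem tau_le {P : Type*} {L L' : Submodule ℂ (HH P)} {p p' : P}
    (h : ∀ f ∈ L, ∃ f' ∈ L', ‖f'‖ ≤ ‖f‖ ∧ f' p' = f p) : tau L p ≤ tau L' p' := by
  refine ContinuousLinearMap.opNorm_le_bound _ (tau_nonneg _ _) ?_
  rintro ⟨f, hf⟩
  obtain ⟨f', hf', hn, he⟩ := h f hf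
  have h1 := norm_le_tau L' p' f' hf'
  have h2 : tau L' p' * ‖f'‖ ≤ tau L' p' * ‖f‖ := mul_le_mul_of_nonneg_left hn (tau_nonneg _ _)
  change ‖f p‖ ≤ tau L' p' * ‖f‖
  rw [← he]
  exact h1.trans h2

theorem tau_mono {P : Type*} {L L' : Submodule ℂ (HH P)} (h : L ≤ L') (p : P) :
    tau L p ≤ tau L' p :=
  tau_le (fun f hf => ⟨f, h hf, le_rfl, rfl⟩)

theorem tau_eq_zero {P : Type*} {L : Submodule ℂ (HH P)} {p : P} (h : ∀ f ∈ L, f p = 0) :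
    tau L p = 0 := by
  apply le_antisymm _ (tau_nonneg _ _)
  refine ContinuousLinearMap.opNorm_le_bound _ le_rfl ?_
  rintro ⟨f, hf⟩
  change ‖f p‖ ≤ _
  simp [h f hf]

open Classical in
noncomputable def del {P : Type*} (p : P) : HH P := lp.single 2 p (1 : ℂ)

theorem inner_del {P : Type*} (p : P) (f : HH P) : inner ℂ (del p) f = f p := by
  classical
  unfold del
  have := lp.inner_single_left (𝕜 := ℂ) (G := fun _ : P => ℂ) p (1 : ℂ) f
  convert this using 1
  simp

theorem tau_eq {P : Type*} (L : Submodule ℂ (HH P)) [L.HasOrthogonalProjection] (p : P) :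
    tau L p = ‖L.starProjection (del p)‖ := by
  have key : ∀ f ∈ L, f p = inner ℂ (L.starProjection (del p)) f := by
    intro f hf
    rw [Submodule.inner_starProjection_left_eq_right,
      Submodule.starProjection_eq_self_iff.2 hf, inner_del]
  apply le_antisymm
  · refine ContinuousLinearMap.opNorm_le_bound _ (norm_nonneg _) ?_
    rintro ⟨f, hf⟩
    change ‖f p‖ ≤ _ * ‖f‖
    rw [key f hf]
    exact norm_inner_le_norm _ _
  · have hm : L.starProjection (del p) ∈ L := Submodule.starProjection_apply_mem _ _
    have h1 := norm_le_tau L p _ hm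
    rw [key _ hm, inner_self_eq_norm_sq_to_K] at h1
    rcases (norm_nonneg (L.starProjection (del p))).eq_or_lt with h | h
    · rw [← h]; exact tau_nonneg _ _
    · have : ‖L.starProjection (del p)‖ * ‖L.starProjection (del p)‖
          ≤ tau L p * ‖L.starProjection (del p)‖ := by
        simpa [pow_two] using h1
      exact le_of_mul_le_mul_right this h

theorem hasSum_normsq {P : Type*} (f : HH P) : HasSum (fun p => ‖f p‖ ^ 2) (‖f‖ ^ 2) := by
  have := lp.hasSum_norm (p := 2) (by norm_num) f
  simpa using this

theorem index_formula {P W : Type*} [NormedAddCommGroup W] [NormedSpace ℂ W]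
    [FiniteDimensional ℂ W] (K : Submodule ℂ (HH P)) (hK : IsClosed (K : Set (HH P)))
    (φ : HH P →L[ℂ] W) :
    HasSum (fun p => tau K p ^ 2 - tau (K ⊓ LinearMap.ker φ.toLinearMap) p ^ 2)
      (Module.finrank ℂ (K.map φ.toLinearMap) : ℝ) := by
  set K' := K ⊓ LinearMap.ker φ.toLinearMap with hK'
  have hcl' : IsClosed (K' : Set (HH P)) := by
    rw [hK', Submodule.coe_inf]
    exact hK.inter (φ.isClosed_ker)
  have : CompleteSpace K := hK.completeSpace_coe
  have : CompleteSpace K' := hcl'.completeSpace_coe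
  set R : Submodule ℂ (HH P) := K ⊓ K'ᗮ with hR
  have hK'K : K' ≤ K := inf_le_left
  -- injectivity
  have hinj : Function.Injective (φ.toLinearMap.domRestrict R) := by
    rw [← LinearMap.ker_eq_bot, LinearMap.ker_eq_bot']
    rintro ⟨f, hf⟩ h0
    have h1 : f ∈ K' := ⟨hf.1, h0⟩
    have h2 : f ∈ K'ᗮ := hf.2
    have h3 : inner ℂ f f = 0 := (Submodule.mem_orthogonal _ _).1 h2 f h1
    ext1
    exact inner_self_eq_zero.1 h3
  have : FiniteDimensional ℂ R := FiniteDimensional.of_injective _ hinj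
  have hrange : LinearMap.range (φ.toLinearMap.domRestrict R) = K.map φ.toLinearMap := by
    apply le_antisymm
    · rintro _ ⟨⟨f, hf⟩, rfl⟩
      exact ⟨f, hf.1, rfl⟩
    · rintro _ ⟨f, hf, rfl⟩
      refine ⟨⟨f - K'.starProjection f, ?_, ?_⟩, ?_⟩
      · exact K.sub_mem hf (hK'K (Submodule.starProjection_apply_mem _ _))
      · exact Submodule.sub_starProjection_mem_orthogonal _
      · have : φ (K'.starProjection f) = 0 :=
          (Submodule.starProjection_apply_mem K' f).2
        change φ (f - K'.starProjection f) = φ f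
        rw [map_sub, this, sub_zero]
  have hfr : Module.finrank ℂ (K.map φ.toLinearMap) = Module.finrank ℂ R := by
    rw [← hrange]
    exact LinearMap.finrank_range_of_inj hinj
  rw [hfr]
  let u := stdOrthonormalBasis ℂ R
  have hterm : ∀ p, tau K p ^ 2 - tau K' p ^ 2 = ∑ a, ‖((u a : R) : HH P) p‖ ^ 2 := by
    intro p
    have hdec : K.starProjection (del p) - K'.starProjection (del p) = R.starProjection (del p) := by
      refine (Submodule.eq_starProjection_of_mem_of_inner_eq_zero ?_ ?_).symm
      · refine ⟨K.sub_mem (Submodule.starProjection_apply_mem _ _)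
          (hK'K (Submodule.starProjection_apply_mem _ _)), ?_⟩
        rw [SetLike.mem_coe, Submodule.mem_orthogonal]
        intro v hv
        rw [inner_sub_right, ← Submodule.inner_starProjection_left_eq_right,
          ← Submodule.inner_starProjection_left_eq_right,
          Submodule.starProjection_eq_self_iff.2 hv,
          Submodule.starProjection_eq_self_iff.2 (hK'K hv), sub_self]
      · intro w hw
        have h1 : K.starProjection w = w := Submodule.starProjection_eq_self_iff.2 hw.1
        have h2 : inner ℂ (K'.starProjection (del p)) w = 0 :=
          (Submodule.mem_orthogonal _ _).1 hw.2 _ (Submodule.starProjection_apply_mem _ _)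
        rw [inner_sub_left, inner_sub_left, h2, Submodule.inner_starProjection_left_eq_right, h1]
        simp
    have horth : inner ℂ (K'.starProjection (del p)) (R.starProjection (del p)) = 0 :=
      (Submodule.mem_orthogonal _ _).1 (Submodule.starProjection_apply_mem R (del p)).2 _
        (Submodule.starProjection_apply_mem _ _)
    have hpyth : ‖K.starProjection (del p)‖ ^ 2
        = ‖K'.starProjection (del p)‖ ^ 2 + ‖R.starProjection (del p)‖ ^ 2 := by
      have : K.starProjection (del p) = K'.starProjection (del p) + R.starProjection (del p) := by
        rw [← hdec]; abel
      rw [this]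
      have := norm_add_sq_eq_norm_sq_add_norm_sq_of_inner_eq_zero _ _ horth
      nlinarith [this]
    rw [tau_eq, tau_eq, hpyth, add_sub_cancel_left]
    have h3 := u.sum_sq_norm_inner_right (R.orthogonalProjectionOnto (del p))
    have h4 : ‖R.starProjection (del p)‖ = ‖R.orthogonalProjectionOnto (del p)‖ := rfl
    rw [h4, ← h3]
    refine Finset.sum_congr rfl fun a _ => ?_
    have h5 : inner ℂ (u a) (R.orthogonalProjectionOnto (del p))
        = inner ℂ ((u a : R) : HH P) (del p) := by
      have h6 : inner ℂ (u a) (R.orthogonalProjectionOnto (del p))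
        = inner ℂ ((u a : R) : HH P) (R.starProjection (del p)) := rfl
      rw [h6, ← Submodule.inner_starProjection_left_eq_right,
        Submodule.starProjection_eq_self_iff.2 (u a).2]
    rw [h5, norm_inner_symm, inner_del]
  have hs : HasSum (fun p => ∑ a, ‖((u a : R) : HH P) p‖ ^ 2)
      (∑ a, ‖((u a : R) : HH P)‖ ^ 2) := hasSum_sum fun a _ => hasSum_normsq _
  have hone : (∑ a, ‖((u a : R) : HH P)‖ ^ 2) = (Module.finrank ℂ R : ℝ) := by
    have : ∀ a, ‖((u a : R) : HH P)‖ = 1 := fun a => u.orthonormal.1 a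
    simp [this]
  rw [← hone]
  simpa only [hterm] using hs

section words
variable {α : Type*}

open Classical in
/-- The last letter of the reduced word. -/
noncomputable def lst (g : FreeGroup α) : Option (α × Bool) := g.toWord.getLast?

/-- The half tree at the identity of words ending in `σ`. -/
def br (σ : α × Bool) : Set (FreeGroup α) := {g | lst g = some σ}

theorem lst_eq_none {g : FreeGroup α} : lst g = none ↔ g = 1 := by
  classical
  unfold lst
  rw [List.getLast?_eq_none_iff, FreeGroup.toWord_eq_nil_iff]

theorem lst_of (a : α) : lst (FreeGroup.of a) = some (a, true) := by
  classical
  unfold lst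
  rw [FreeGroup.toWord_of]; rfl

theorem one_notMem_br (σ : α × Bool) : (1 : FreeGroup α) ∉ br σ := by
  intro h
  have : lst (1 : FreeGroup α) = none := lst_eq_none.2 rfl
  rw [br, Set.mem_ofPred_eq, this] at h
  cases h

theorem lst_of_mul (a : α) (g : FreeGroup α) (h : g ≠ 1) (h' : FreeGroup.of a * g ≠ 1) :
    lst (FreeGroup.of a * g) = lst g := by
  classical
  unfold lst
  have h1 : g.toWord ≠ [] := fun e => h (FreeGroup.toWord_eq_nil_iff.1 e)
  have h2 : (FreeGroup.of a * g).toWord ≠ [] := fun e => h' (FreeGroup.toWord_eq_nil_iff.1 e)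
  have h3 : (FreeGroup.of a * g).toWord = FreeGroup.reduce ((a, true) :: g.toWord) := by
    rw [FreeGroup.toWord_mul, FreeGroup.toWord_of]; rfl
  rw [h3] at h2 ⊢
  rw [FreeGroup.reduce.cons, FreeGroup.reduce_toWord] at h2 ⊢
  rcases hg : g.toWord with _ | ⟨b, l⟩
  · exact absurd hg h1
  · rw [hg] at h2
    simp only at h2 ⊢
    split_ifs at h2 ⊢ with hc
    · rcases l with _ | ⟨c, l⟩
      · simp at h2
      · simp [List.getLast?_cons_cons]
    · simp [List.getLast?_cons_cons]

theorem br_T1 (σ : α × Bool) (i : α) (x : FreeGroup α) (h : x ∈ br σ)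
    (h' : (FreeGroup.of i)⁻¹ * x ∉ br σ) : (FreeGroup.of i)⁻¹ * x = 1 := by
  by_contra hne
  apply h'
  have hx : x ≠ 1 := fun e => one_notMem_br σ (e ▸ h)
  have := lst_of_mul i ((FreeGroup.of i)⁻¹ * x) hne (by rwa [mul_inv_cancel_left])
  rw [mul_inv_cancel_left] at this
  rw [br, Set.mem_ofPred_eq, ← this]
  exact h

theorem br_T2 (σ : α × Bool) (i : α) (x : FreeGroup α) (h : x ∉ br σ)
    (h' : (FreeGroup.of i)⁻¹ * x ∈ br σ) : x = 1 := by
  by_contra hne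
  apply h
  have hx : (FreeGroup.of i)⁻¹ * x ≠ 1 := fun e => one_notMem_br σ (e ▸ h')
  have := lst_of_mul i ((FreeGroup.of i)⁻¹ * x) hx (by rwa [mul_inv_cancel_left])
  rw [mul_inv_cancel_left] at this
  rw [br, Set.mem_ofPred_eq, this]
  exact h'

theorem toWord_mul_letter [DecidableEq α] (g : FreeGroup α) (σ : α × Bool)
    (h : g.toWord.getLast? ≠ some (σ.1, !σ.2)) :
    (g * FreeGroup.mk [σ]).toWord = g.toWord ++ [σ] := by
  rw [FreeGroup.toWord_mul, FreeGroup.toWord_mk, FreeGroup.reduce_singleton]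
  apply FreeGroup.IsReduced.reduce_eq
  have := FreeGroup.isReduced_toWord (x := g)
  unfold FreeGroup.IsReduced at this ⊢
  rw [List.isChain_append]
  refine ⟨this, by simp, ?_⟩
  intro a ha b hb
  simp only [List.head?_cons, Option.mem_def, Option.some.injEq] at hb
  subst hb
  intro h1
  by_contra h2
  apply h
  rw [Option.mem_def] at ha
  rw [ha]
  congr 1
  ext1
  · exact h1
  · revert h2
    cases a.2 <;> cases σ.2 <;> simp

theorem br_T3 (i : α) (g : FreeGroup α) :
    g * FreeGroup.of i ∉ br (i, true) ↔ g ∈ br (i, false) := by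
  classical
  constructor
  · intro h
    have := toWord_mul_letter (g * FreeGroup.of i) (i, false) h
    have h2 : g * FreeGroup.of i * FreeGroup.mk [(i, false)] = g := by
      have : FreeGroup.mk [(i, false)] = (FreeGroup.of i)⁻¹ := rfl
      rw [this, mul_inv_cancel_right]
    rw [h2] at this
    simp [br, lst, this]
  · intro h h3
    have h1 : g.toWord.getLast? = some (i, false) := h
    rw [List.getLast?_eq_some_iff] at h1
    obtain ⟨w, hw⟩ := h1
    have hred := FreeGroup.isReduced_toWord (x := g)
    rw [hw] at hred
    unfold FreeGroup.IsReduced at hred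
    rw [List.isChain_append] at hred
    have hg : g * FreeGroup.of i = FreeGroup.mk w := by
      have h4 : g = FreeGroup.mk w * (FreeGroup.of i)⁻¹ := by
        have h5 : (FreeGroup.of i)⁻¹ = FreeGroup.mk [(i, false)] := rfl
        rw [h5, FreeGroup.mul_mk, ← hw, FreeGroup.mk_toWord]
      rw [h4, inv_mul_cancel_right]
    have h6 : w.getLast? = some (i, true) := by
      have h7 : (g * FreeGroup.of i).toWord.getLast? = some (i, true) := h3
      rw [hg, FreeGroup.toWord_mk, FreeGroup.IsReduced.reduce_eq hred.1] at h7
      exact h7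
    have := hred.2.2 (i, true) h6 (i, false) rfl rfl
    simp at this

end words

section key

theorem exists_reindex {P : Type*} (e : P ≃ P) (f : HH P) :
    ∃ f' : HH P, ‖f'‖ ≤ ‖f‖ ∧ ∀ p, f' p = f (e p) := by
  have h1 : HasSum (fun p => ‖f (e p)‖ ^ 2) (‖f‖ ^ 2) := e.hasSum_iff.2 (hasSum_normsq f)
  have hm : Memℓp (fun p => f (e p)) 2 := by
    apply memℓp_gen
    simpa using h1.summable
  refine ⟨⟨_, hm⟩, ?_, fun p => rfl⟩
  have h2 := (hasSum_normsq (⟨_, hm⟩ : HH P)).unique h1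
  exact le_of_sq_le_sq h2.le (norm_nonneg _)

open Classical in
theorem exists_restrict {P : Type*} (S : Set P) (f : HH P) :
    ∃ f' : HH P, ‖f'‖ ≤ ‖f‖ ∧ ∀ p, f' p = if p ∈ S then f p else 0 := by
  have hle : ∀ p, ‖(if p ∈ S then f p else 0 : ℂ)‖ ^ 2 ≤ ‖f p‖ ^ 2 := by
    intro p
    split_ifs
    · exact le_rfl
    · simp
  have hm : Memℓp (fun p => (if p ∈ S then f p else 0 : ℂ)) 2 := by
    apply memℓp_gen
    have := Summable.of_nonneg_of_le (fun p => by positivity) hle (hasSum_normsq f).summable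
    simpa using this
  refine ⟨⟨_, hm⟩, ?_, fun p => rfl⟩
  have h2 := hasSum_le hle (hasSum_normsq (⟨_, hm⟩ : HH P)) (hasSum_normsq f)
  exact le_of_sq_le_sq h2 (norm_nonneg _)

variable {α ι : Type*} [Fintype ι]

noncomputable def evv (x : FreeGroup α) : HH (FreeGroup α × ι) →L[ℂ] (ι → ℂ) :=
  ContinuousLinearMap.pi fun j => evp (x, j)

theorem evv_apply (x : FreeGroup α) (f : HH (FreeGroup α × ι)) (j : ι) :
    evv x f j = f (x, j) := rfl

noncomputable def act (B : Matrix ι ι ℂ) (x : FreeGroup α) :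
    HH (FreeGroup α × ι) →L[ℂ] (ι → ℂ) :=
  (LinearMap.toContinuousLinearMap B.mulVecLin).comp (evv x)

theorem act_apply (B : Matrix ι ι ℂ) (x : FreeGroup α) (f : HH (FreeGroup α × ι)) :
    act B x f = B.mulVec (evv x f) := rfl

noncomputable def eqn (s : Finset α) (N : α → Matrix ι ι ℂ) (x : FreeGroup α) :
    HH (FreeGroup α × ι) →L[ℂ] (ι → ℂ) :=
  evv x - ∑ i ∈ s, (act (N i) x - act (N i) ((FreeGroup.of i)⁻¹ * x))

noncomputable def KK (s : Finset α) (N : α → Matrix ι ι ℂ) :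
    Submodule ℂ (HH (FreeGroup α × ι)) :=
  ⨅ x, LinearMap.ker (eqn s N x).toLinearMap

theorem mem_KK {s : Finset α} {N : α → Matrix ι ι ℂ} {f : HH (FreeGroup α × ι)} :
    f ∈ KK s N ↔ ∀ x, evv x f =
      ∑ i ∈ s, ((N i).mulVec (evv x f) - (N i).mulVec (evv ((FreeGroup.of i)⁻¹ * x) f)) := by
  unfold KK
  rw [Submodule.mem_iInf]
  refine forall_congr' fun x => ?_
  rw [LinearMap.mem_ker]
  change eqn s N x f = 0 ↔ _
  unfold eqn
  rw [sub_apply, sub_eq_zero, sum_apply]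
  rfl

theorem isClosed_KK (s : Finset α) (N : α → Matrix ι ι ℂ) :
    IsClosed (KK s N : Set (HH (FreeGroup α × ι))) := by
  unfold KK
  rw [Submodule.coe_iInf]
  exact isClosed_iInter fun x => (eqn s N x).isClosed_ker

/-- Members of the kernel supported in `S`. -/
def LL (s : Finset α) (N : α → Matrix ι ι ℂ) (S : Set (FreeGroup α)) :
    Submodule ℂ (HH (FreeGroup α × ι)) where
  carrier := {f | f ∈ KK s N ∧ ∀ x, x ∉ S → evv x f = 0}
  add_mem' := by
    rintro f g ⟨hf, hf'⟩ ⟨hg, hg'⟩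
    exact ⟨Submodule.add_mem _ hf hg, fun x hx => by rw [map_add, hf' x hx, hg' x hx, add_zero]⟩
  zero_mem' := ⟨Submodule.zero_mem _, fun x _ => map_zero _⟩
  smul_mem' := by
    rintro c f ⟨hf, hf'⟩
    exact ⟨Submodule.smul_mem _ c hf, fun x hx => by rw [map_smul, hf' x hx, smul_zero]⟩

theorem LL_le (s : Finset α) (N : α → Matrix ι ι ℂ) (S : Set (FreeGroup α)) :
    LL s N S ≤ KK s N := fun _ h => h.1

theorem exists_translate (s : Finset α) (N : α → Matrix ι ι ℂ) (h : FreeGroup α)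
    (f : HH (FreeGroup α × ι)) (hf : f ∈ KK s N) :
    ∃ f' ∈ KK s N, ‖f'‖ ≤ ‖f‖ ∧ ∀ x, evv x f' = evv (x * h) f := by
  obtain ⟨f', hn, he⟩ := exists_reindex
    (Equiv.prodCongr (Equiv.mulRight h) (Equiv.refl ι)) f
  have he' : ∀ x, evv x f' = evv (x * h) f := by
    intro x; ext j
    exact he (x, j)
  refine ⟨f', ?_, hn, he'⟩
  rw [mem_KK] at hf ⊢
  intro x
  simp only [he', mul_assoc]
  exact hf (x * h)

theorem tau_translate_le (s : Finset α) (N : α → Matrix ι ι ℂ) (S S' : Set (FreeGroup α))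
    (h : FreeGroup α) (hS : ∀ x, x * h ∈ S → x ∈ S') (x : FreeGroup α) (j : ι) :
    tau (LL s N S) (x * h, j) ≤ tau (LL s N S') (x, j) := by
  apply tau_le
  rintro f ⟨hf, hf'⟩
  obtain ⟨f', hK, hn, he⟩ := exists_translate s N h f hf
  refine ⟨f', ⟨hK, fun y hy => ?_⟩, hn, ?_⟩
  · rw [he, hf']
    exact fun h' => hy (hS y h')
  · exact congrFun (he x) j

theorem tau_KK (s : Finset α) (N : α → Matrix ι ι ℂ) (x y : FreeGroup α) (j : ι) :
    tau (KK s N) (x, j) = tau (KK s N) (y, j) := by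
  have : ∀ x y : FreeGroup α, tau (KK s N) (x, j) ≤ tau (KK s N) (y, j) := by
    intro x y
    apply tau_le
    intro f hf
    obtain ⟨f', hK, hn, he⟩ := exists_translate s N (y⁻¹ * x) f hf
    refine ⟨f', hK, hn, ?_⟩
    have := congrFun (he y) j
    rw [mul_inv_cancel_left] at this
    exact this
  exact le_antisymm (this _ _) (this _ _)

/-- The edge map. -/
theorem LL_br_le (s : Finset α) (N : α → Matrix ι ι ℂ) (i : α) :
    LL s N (br (i, true)) ≤ KK s N ⊓ LinearMap.ker (act (N i) 1).toLinearMap := by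
  rintro f ⟨hf, hf'⟩
  refine ⟨hf, ?_⟩
  change act (N i) 1 f = 0
  rw [act_apply, hf' 1 (one_notMem_br _), Matrix.mulVec_zero]

theorem LL_br_compl_le (s : Finset α) (N : α → Matrix ι ι ℂ) (i : α) (hi : i ∈ s) :
    LL s N (br (i, true))ᶜ ≤ KK s N ⊓ LinearMap.ker (act (N i) 1).toLinearMap := by
  classical
  rintro f ⟨hf, hf'⟩
  refine ⟨hf, ?_⟩
  change act (N i) 1 f = 0
  have hx : FreeGroup.of i ∈ br (i, true) := lst_of i
  have h1 := mem_KK.1 hf (FreeGroup.of i)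
  rw [hf' _ (by simpa using hx), Finset.sum_eq_single_of_mem i hi] at h1
  · rw [inv_mul_cancel, Matrix.mulVec_zero, zero_sub] at h1
    rw [act_apply]
    exact neg_eq_zero.1 h1.symm
  · intro j hj hji
    have : (FreeGroup.of j)⁻¹ * FreeGroup.of i ∈ br (i, true) := by
      by_contra hcon
      have h2 := br_T1 _ _ _ hx hcon
      rw [inv_mul_eq_one] at h2
      exact hji (FreeGroup.of_injective h2)
    rw [hf' _ (by simpa using this)]
    simp

/-- The vertex map. -/
noncomputable def vmap (s : Finset α) (N : α → Matrix ι ι ℂ) :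
    HH (FreeGroup α × ι) →L[ℂ] (s → ι → ℂ) :=
  ContinuousLinearMap.pi fun i => act (N i) (FreeGroup.of (i : α))⁻¹ - act (N i) 1

theorem vmap_ker (s : Finset α) (N : α → Matrix ι ι ℂ) (f : HH (FreeGroup α × ι))
    (hf : f ∈ KK s N ⊓ LinearMap.ker (vmap s N).toLinearMap) :
    evv 1 f = 0 ∧ ∀ i ∈ s, (N i).mulVec (evv (FreeGroup.of i)⁻¹ f) = 0 := by
  have h0 : ∀ i ∈ s, (N i).mulVec (evv (FreeGroup.of i)⁻¹ f) = (N i).mulVec (evv 1 f) := by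
    intro i hi
    have h1 : vmap s N f = 0 := hf.2
    exact sub_eq_zero.1 (congrFun h1 ⟨i, hi⟩)
  have h2 : evv 1 f = 0 := by
    rw [mem_KK.1 hf.1 1]
    refine Finset.sum_eq_zero fun i hi => ?_
    rw [mul_one, h0 i hi, sub_self]
  refine ⟨h2, fun i hi => ?_⟩
  rw [h0 i hi, h2, Matrix.mulVec_zero]

theorem tau_vertex_le (s : Finset α) (N : α → Matrix ι ι ℂ) (σ : α × Bool)
    (g : FreeGroup α) (hg : g ∈ br σ) (j : ι) :
    tau (KK s N ⊓ LinearMap.ker (vmap s N).toLinearMap) (g, j) ≤ tau (LL s N (br σ)) (g, j) := by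
  classical
  apply tau_le
  intro f hf
  obtain ⟨h1, h2⟩ := vmap_ker s N f hf
  obtain ⟨f', hn, he⟩ := exists_restrict {p : FreeGroup α × ι | p.1 ∈ br σ} f
  have hin : ∀ x, x ∈ br σ → evv x f' = evv x f := by
    intro x hx; ext j
    rw [evv_apply, evv_apply, he, if_pos]
    exact hx
  have hout : ∀ x, x ∉ br σ → evv x f' = 0 := by
    intro x hx; ext j
    rw [evv_apply, he, if_neg]
    · rfl
    · exact hx
  refine ⟨f', ⟨?_, hout⟩, hn, congrFun (hin g hg) j⟩
  rw [mem_KK]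
  intro x
  by_cases hx : x ∈ br σ
  · rw [hin x hx]
    conv_lhs => rw [mem_KK.1 hf.1 x]
    refine Finset.sum_congr rfl fun i hi => ?_
    congr 2
    by_cases hy : (FreeGroup.of i)⁻¹ * x ∈ br σ
    · rw [hin _ hy]
    · rw [hout _ hy, br_T1 _ _ _ hx hy, h1]
  · rw [hout x hx, eq_comm]
    refine Finset.sum_eq_zero fun i hi => ?_
    rw [Matrix.mulVec_zero, zero_sub, neg_eq_zero]
    by_cases hy : (FreeGroup.of i)⁻¹ * x ∈ br σ
    · have hx1 := br_T2 _ _ _ hx hy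
      rw [hin _ hy, hx1, mul_one]
      exact h2 i hi
    · rw [hout _ hy, Matrix.mulVec_zero]

theorem finrank_vmap_le (s : Finset α) (N : α → Matrix ι ι ℂ) :
    Module.finrank ℂ ((KK s N).map (vmap s N).toLinearMap) ≤
      ∑ i ∈ s, Module.finrank ℂ ((KK s N).map (act (N i) 1).toLinearMap) := by
  let V : s → Submodule ℂ (ι → ℂ) := fun i => (KK s N).map (act (N i) 1).toLinearMap
  have hmem : ∀ w ∈ (KK s N).map (vmap s N).toLinearMap, ∀ i, w i ∈ V i := by
    rintro _ ⟨f, hf, rfl⟩ i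
    refine Submodule.sub_mem _ ?_ ?_
    · obtain ⟨f', hK, -, he⟩ := exists_translate s N (FreeGroup.of (i : α))⁻¹ f hf
      refine ⟨f', hK, ?_⟩
      change act (N i) 1 f' = act (N i) _ f
      rw [act_apply, act_apply, he, one_mul]
    · exact ⟨f, hf, rfl⟩
  let θ : ((KK s N).map (vmap s N).toLinearMap) →ₗ[ℂ] (∀ i, V i) :=
    { toFun := fun w i => ⟨w.1 i, hmem w.1 w.2 i⟩
      map_add' := fun _ _ => rfl
      map_smul' := fun _ _ => rfl }
  have hθ : Function.Injective θ := by
    intro a b hab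
    ext1
    funext i
    exact congrArg Subtype.val (congrFun hab i)
  have h1 := LinearMap.finrank_le_finrank_of_injective hθ
  rw [Module.finrank_pi_fintype] at h1
  refine h1.trans_eq ?_
  exact Finset.sum_coe_sort s (fun i => Module.finrank ℂ ((KK s N).map (act (N i) 1).toLinearMap))

end key

section count
open scoped ENNReal
variable {α ι : Type*} [Fintype ι]

/-- Local defect of a subspace of the kernel. -/
noncomputable def dft (s : Finset α) (N : α → Matrix ι ι ℂ)
    (L : Submodule ℂ (HH (FreeGroup α × ι))) (g : FreeGroup α) : ℝ :=
  ∑ j, (tau (KK s N) (g, j) ^ 2 - tau L (g, j) ^ 2)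

theorem dft_nonneg (s : Finset α) (N : α → Matrix ι ι ℂ)
    (L : Submodule ℂ (HH (FreeGroup α × ι))) (h : L ≤ KK s N) (g : FreeGroup α) :
    0 ≤ dft s N L g :=
  Finset.sum_nonneg fun j _ => sub_nonneg.2
    (pow_le_pow_left₀ (tau_nonneg _ _) (tau_mono h _) 2)

theorem dft_anti (s : Finset α) (N : α → Matrix ι ι ℂ)
    (L L' : Submodule ℂ (HH (FreeGroup α × ι))) (g g' : FreeGroup α)
    (h : ∀ j, tau L (g, j) ≤ tau L' (g', j)) :
    dft s N L' g' ≤ dft s N L g := by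
  refine Finset.sum_le_sum fun j _ => ?_
  rw [tau_KK s N g' g]
  exact sub_le_sub_left (pow_le_pow_left₀ (tau_nonneg _ _) (h j) 2) _

theorem tsum_dft {W : Type*} [NormedAddCommGroup W] [NormedSpace ℂ W]
    [FiniteDimensional ℂ W] (s : Finset α) (N : α → Matrix ι ι ℂ)
    (φ : HH (FreeGroup α × ι) →L[ℂ] W) :
    ∑' g, ENNReal.ofReal (dft s N (KK s N ⊓ LinearMap.ker φ.toLinearMap) g) =
      (Module.finrank ℂ ((KK s N).map φ.toLinearMap) : ℝ≥0∞) := by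
  have h1 := index_formula (KK s N) (isClosed_KK s N) φ
  have h2 : HasSum (dft s N (KK s N ⊓ LinearMap.ker φ.toLinearMap)) _ :=
    h1.prod_fiberwise (fun g => hasSum_fintype _)
  rw [← ENNReal.ofReal_tsum_of_nonneg (fun g => dft_nonneg s N _ inf_le_left g) h2.summable,
    h2.tsum_eq, ENNReal.ofReal_natCast]

/-- The defect carried by a half tree. -/
noncomputable def hd (s : Finset α) (N : α → Matrix ι ι ℂ) (σ : α × Bool)
    (g : FreeGroup α) : ℝ≥0∞ :=
  (br σ).indicator (fun g => ENNReal.ofReal (dft s N (LL s N (br σ)) g)) g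

theorem edge_count (s : Finset α) (N : α → Matrix ι ι ℂ) (i : α) (hi : i ∈ s) :
    (Module.finrank ℂ ((KK s N).map (act (N i) 1).toLinearMap) : ℝ≥0∞) ≤
      ∑' g, hd s N (i, true) g + ∑' g, hd s N (i, false) g := by
  classical
  rw [← tsum_dft, ← (Equiv.mulRight (FreeGroup.of i)⁻¹).tsum_eq (hd s N (i, false)),
    ← ENNReal.tsum_add]
  refine ENNReal.tsum_le_tsum fun g => ?_
  by_cases hg : g ∈ br (i, true)
  · refine le_trans ?_ le_self_add
    unfold hd
    rw [Set.indicator_of_mem hg]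
    exact ENNReal.ofReal_le_ofReal (dft_anti _ _ _ _ _ _
      fun j => tau_mono (LL_br_le s N i) _)
  · refine le_trans ?_ le_add_self
    have hg' : g * (FreeGroup.of i)⁻¹ ∈ br (i, false) := by
      rw [← br_T3, inv_mul_cancel_right]; exact hg
    change _ ≤ hd s N (i, false) (g * (FreeGroup.of i)⁻¹)
    unfold hd
    rw [Set.indicator_of_mem hg']
    refine ENNReal.ofReal_le_ofReal (dft_anti _ _ _ _ _ _ fun j => ?_)
    have h1 : tau (LL s N (br (i, true))ᶜ) (g, j) ≤ _ :=
      tau_mono (LL_br_compl_le s N i hi) _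
    refine le_trans ?_ h1
    have h2 := tau_translate_le s N (br (i, false)) (br (i, true))ᶜ (FreeGroup.of i)⁻¹ (by
      intro x hx
      rw [← br_T3, inv_mul_cancel_right] at hx
      exact hx) g j
    exact h2

theorem vertex_count (s : Finset α) (N : α → Matrix ι ι ℂ) :
    ENNReal.ofReal (∑ j, tau (KK s N) (1, j) ^ 2)
      + ∑ i ∈ s, (∑' g, hd s N (i, true) g + ∑' g, hd s N (i, false) g) ≤
    (Module.finrank ℂ ((KK s N).map (vmap s N).toLinearMap) : ℝ≥0∞) := by
  classical
  rw [← tsum_dft]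
  have h1 : ∑ i ∈ s, (∑' g, hd s N (i, true) g + ∑' g, hd s N (i, false) g)
      = ∑' g, ∑ σ ∈ s ×ˢ (Finset.univ : Finset Bool), hd s N σ g := by
    rw [Summable.tsum_finsetSum (fun _ _ => ENNReal.summable), Finset.sum_product]
    refine Finset.sum_congr rfl fun i _ => ?_
    rw [Fintype.sum_bool]
  have h2 : ENNReal.ofReal (∑ j, tau (KK s N) (1, j) ^ 2)
      = ∑' g : FreeGroup α, if g = 1 then
          ENNReal.ofReal (∑ j, tau (KK s N) (1, j) ^ 2) else 0 := by
    rw [tsum_ite_eq]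
  rw [h1, h2, ← ENNReal.tsum_add]
  refine ENNReal.tsum_le_tsum fun g => ?_
  by_cases hg : g = 1
  · subst hg
    have hz : ∑ σ ∈ s ×ˢ (Finset.univ : Finset Bool), hd s N σ (1 : FreeGroup α) = 0 := by
      refine Finset.sum_eq_zero fun σ _ => ?_
      unfold hd
      rw [Set.indicator_of_notMem (one_notMem_br σ)]
    rw [if_pos rfl, hz, add_zero]
    · apply ENNReal.ofReal_le_ofReal
      unfold dft
      refine Finset.sum_le_sum fun j _ => ?_
      rw [tau_eq_zero (L := KK s N ⊓ LinearMap.ker (vmap s N).toLinearMap)]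
      · simp
      · intro f hf
        exact congrFun (vmap_ker s N f hf).1 j
  · rw [if_neg hg, zero_add]
    obtain ⟨σ, hσ⟩ := Option.ne_none_iff_exists'.1 (fun h => hg (lst_eq_none.1 h))
    have hle : ∑ σ' ∈ s ×ˢ (Finset.univ : Finset Bool), hd s N σ' g ≤ hd s N σ g := by
      by_cases hs : σ ∈ s ×ˢ (Finset.univ : Finset Bool)
      · rw [Finset.sum_eq_single_of_mem σ hs]
        intro τ _ hne
        apply Set.indicator_of_notMem
        intro hm
        have hm' : lst g = some τ := hm
        rw [hσ] at hm'
        exact hne (Option.some.inj hm').symm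
      · rw [Finset.sum_eq_zero]
        · exact zero_le
        · intro τ hτ
          apply Set.indicator_of_notMem
          intro hm
          have hm' : lst g = some τ := hm
          rw [hσ] at hm'
          exact hs ((Option.some.inj hm') ▸ hτ)
    refine hle.trans ?_
    have hm : g ∈ br σ := hσ
    unfold hd
    rw [Set.indicator_of_mem hm]
    exact ENNReal.ofReal_le_ofReal (dft_anti _ _ _ _ _ _ fun j => tau_vertex_le s N σ g hm j)

theorem KK_eq_bot (s : Finset α) (N : α → Matrix ι ι ℂ) : KK s N = ⊥ := by
  have h1 := vertex_count s N
  have h2 : (Module.finrank ℂ ((KK s N).map (vmap s N).toLinearMap) : ℝ≥0∞) ≤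
      ∑ i ∈ s, (∑' g, hd s N (i, true) g + ∑' g, hd s N (i, false) g) := by
    calc (Module.finrank ℂ ((KK s N).map (vmap s N).toLinearMap) : ℝ≥0∞)
        ≤ ((∑ i ∈ s, Module.finrank ℂ ((KK s N).map (act (N i) 1).toLinearMap) : ℕ) : ℝ≥0∞) := by
          exact_mod_cast finrank_vmap_le s N
      _ = ∑ i ∈ s, (Module.finrank ℂ ((KK s N).map (act (N i) 1).toLinearMap) : ℝ≥0∞) := by
          push_cast; rfl
      _ ≤ _ := Finset.sum_le_sum fun i hi => edge_count s N i hi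
  set X := ∑ i ∈ s, (∑' g, hd s N (i, true) g + ∑' g, hd s N (i, false) g) with hX
  have hfin : X ≠ ∞ := by
    refine ne_top_of_le_ne_top ?_ (le_add_self.trans h1)
    exact ENNReal.natCast_ne_top _
  have h3 : ENNReal.ofReal (∑ j, tau (KK s N) (1, j) ^ 2) + X ≤ 0 + X := by
    rw [zero_add]; exact h1.trans h2
  have h4 := (ENNReal.add_le_add_iff_right hfin).1 h3
  have h5 : ∑ j, tau (KK s N) (1, j) ^ 2 ≤ 0 := by
    rwa [nonpos_iff_eq_zero, ENNReal.ofReal_eq_zero] at h4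
  have h6 : ∀ j, tau (KK s N) (1, j) = 0 := by
    intro j
    have h7 : tau (KK s N) (1, j) ^ 2 ≤ 0 :=
      (Finset.single_le_sum (f := fun j => tau (KK s N) (1, j) ^ 2)
        (fun j _ => sq_nonneg _) (Finset.mem_univ j)).trans h5
    exact pow_eq_zero_iff (two_ne_zero) |>.1 (le_antisymm h7 (sq_nonneg _))
  rw [eq_bot_iff]
  intro f hf
  rw [Submodule.mem_bot]
  ext ⟨x, j⟩
  have h8 := norm_le_tau _ (x, j) f hf
  rw [tau_KK s N x 1, h6, zero_mul] at h8
  exact norm_le_zero_iff.1 h8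

end count

section reduction
variable {α : Type*}

/-- A finite family of square summable functions that is divergence of itself vanishes. -/
theorem family_zero {ι : Type*} [Fintype ι] (F : HH (FreeGroup α × ι))
    (h : ∀ j, (fun x => F (x, j)) ∈ Submodule.span ℂ (Set.range
      (fun (q : α × ι) (x : FreeGroup α) =>
        (F (x, q.2) - F ((FreeGroup.of q.1)⁻¹ * x, q.2) : ℂ)))) : F = 0 := by
  classical
  simp only [Finsupp.mem_span_range_iff_exists_finsupp] at h
  choose c hc using h
  let s : Finset α := Finset.univ.biUnion fun j => (c j).support.image Prod.fst
  let N : α → Matrix ι ι ℂ := fun i => Matrix.of fun j k => c j (i, k)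
  have : F ∈ KK s N := by
    rw [mem_KK]
    intro x
    ext j
    have h1 := congrFun (hc j) x
    rw [evv_apply, ← h1, Finsupp.sum_of_support_subset (s := s ×ˢ Finset.univ)]
    · rw [Finset.sum_product, Finset.sum_apply, Finset.sum_apply]
      refine Finset.sum_congr rfl fun i _ => ?_
      rw [Finset.sum_apply]
      simp only [Pi.smul_apply, smul_eq_mul, Pi.sub_apply, Matrix.mulVec, dotProduct,
        evv_apply, N, Matrix.of_apply]
      rw [← Finset.sum_sub_distrib]
      exact Finset.sum_congr rfl fun k _ => mul_sub _ _ _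
    · intro q hq
      simp only [Finset.mem_product, Finset.mem_univ, and_true, s, Finset.mem_biUnion,
        true_and, Finset.mem_image]
      exact ⟨j, q, hq, rfl⟩
    · intro i _
      exact zero_smul _ _
  rw [KK_eq_bot] at this
  exact this

theorem eig_zero {d : ℕ} (A : FreeGroup α →₀ Matrix (Fin d) (Fin d) ℂ) (lam : ℂ)
    (f : HH (FreeGroup α × Fin d))
    (hf : ∀ x i, ∑ g ∈ A.support, ∑ j : Fin d, A g i j * f (g⁻¹ * x, j) = lam * f (x, i))
    (hdet : IsUnit ((∑ g ∈ A.support, A g) - lam • (1 : Matrix (Fin d) (Fin d) ℂ))) : f = 0 := by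
  classical
  let B : Finset (List (α × Bool)) :=
    (insert 1 A.support).biUnion fun g => g.toWord.tails.toFinset
  have hBnil : [] ∈ B := by
    simp [B]
  have hBsuf : ∀ a L, a :: L ∈ B → L ∈ B := by
    intro a L h
    simp only [B, Finset.mem_biUnion, List.mem_toFinset, List.mem_tails] at h ⊢
    obtain ⟨g, hg, h⟩ := h
    exact ⟨g, hg, (List.suffix_cons a L).trans h⟩
  have hBsupp : ∀ g ∈ A.support, g.toWord ∈ B := by
    intro g hg
    simp only [B, Finset.mem_biUnion, List.mem_toFinset, List.mem_tails]
    exact ⟨g, Finset.mem_insert_of_mem hg, List.suffix_rfl⟩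
  let v : List (α × Bool) → Fin d → FreeGroup α → ℂ :=
    fun L k x => f ((FreeGroup.mk L)⁻¹ * x, k)
  have hm : Memℓp (fun p : FreeGroup α × (B × Fin d) => v p.2.1 p.2.2 p.1) 2 := by
    apply memℓp_gen
    let e : B × (FreeGroup α × Fin d) ≃ FreeGroup α × (B × Fin d) :=
      { toFun := fun p => (p.2.1, (p.1, p.2.2))
        invFun := fun p => (p.2.1, (p.1, p.2.2))
        left_inv := fun _ => rfl
        right_inv := fun _ => rfl }
    rw [← e.summable_iff, summable_prod_of_nonneg]
    · refine ⟨fun b => ?_, (hasSum_fintype _).summable⟩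
      have h1 := ((Equiv.prodCongr (Equiv.mulLeft (FreeGroup.mk b.1)⁻¹)
        (Equiv.refl (Fin d))).summable_iff).2 (hasSum_normsq f).summable
      refine h1.congr fun p => ?_
      rcases p with ⟨x, k⟩
      simp [e, v]
    · intro p
      simp only [Pi.zero_apply, Function.comp]
      positivity
  let F : HH (FreeGroup α × (B × Fin d)) := ⟨_, hm⟩
  have hF : ∀ x b k, F (x, (b, k)) = v b.1 k x := fun _ _ _ => rfl
  set W := Submodule.span ℂ (Set.range
      (fun (q : α × (B × Fin d)) (x : FreeGroup α) =>
        (F (x, q.2) - F ((FreeGroup.of q.1)⁻¹ * x, q.2) : ℂ))) with hW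
  have hgen : ∀ (i : α) (L : List (α × Bool)) (k : Fin d), L ∈ B →
      (fun x => v L k x - v L k ((FreeGroup.of i)⁻¹ * x)) ∈ W := by
    intro i L k hL
    exact Submodule.subset_span ⟨(i, (⟨L, hL⟩, k)), rfl⟩
  have hstep : ∀ a L k, a :: L ∈ B → v L k - v (a :: L) k ∈ W := by
    rintro ⟨i, b⟩ L k hL
    cases b
    · have h1 := W.neg_mem (hgen i _ k hL)
      convert h1 using 1
      ext x
      have h2 : FreeGroup.mk ((i, false) :: L) = (FreeGroup.of i)⁻¹ * FreeGroup.mk L := rfl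
      simp only [v, h2, Pi.sub_apply, Pi.neg_apply, mul_inv_rev, inv_inv, mul_assoc,
        mul_inv_cancel_left]
      ring
    · have h1 := hgen i _ k (hBsuf _ _ hL)
      convert h1 using 1
      ext x
      have h2 : FreeGroup.mk ((i, true) :: L) = (FreeGroup.of i) * FreeGroup.mk L := rfl
      simp only [v, h2, Pi.sub_apply, mul_inv_rev, mul_assoc]
  have hall : ∀ L k, L ∈ B → v [] k - v L k ∈ W := by
    intro L k
    induction L with
    | nil => intro _; rw [sub_self]; exact W.zero_mem
    | cons a L ih =>
      intro hL
      have := W.add_mem (ih (hBsuf _ _ hL)) (hstep a L k hL)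
      rwa [sub_add_sub_cancel] at this
  set E := (∑ g ∈ A.support, A g) - lam • (1 : Matrix (Fin d) (Fin d) ℂ) with hE
  have hnil : ∀ k x, v [] k x = f (x, k) := by
    intro k x
    have : (FreeGroup.mk ([] : List (α × Bool))) = 1 := rfl
    simp only [v, this, inv_one, one_mul]
  have hrel : ∀ i, ∑ j, E i j • v [] j ∈ W := by
    intro i
    have h1 : ∑ j, E i j • v [] j
        = ∑ g ∈ A.support, ∑ j, A g i j • (v [] j - v g.toWord j) := by
      ext x
      have h2 := hf x i
      simp only [Finset.sum_apply, Pi.smul_apply, Pi.sub_apply, smul_eq_mul, hnil]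
      have h3 : ∀ g j, v (FreeGroup.toWord g) j x = f (g⁻¹ * x, j) := by
        intro g j; simp only [v, FreeGroup.mk_toWord]
      simp only [h3, mul_sub, Finset.sum_sub_distrib]
      rw [h2]
      simp only [hE, Matrix.sub_apply, Matrix.sum_apply, Matrix.smul_apply, smul_eq_mul, sub_mul,
        Finset.sum_sub_distrib, Finset.sum_mul]
      rw [Finset.sum_comm]
      congr 1
      simp [Matrix.one_apply]
    rw [h1]
    exact W.sum_mem fun g hg => W.sum_mem fun j _ => W.smul_mem _ (hall _ j (hBsupp g hg))
  obtain ⟨C, hC⟩ := hdet.exists_left_inv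
  have hbase : ∀ k, v [] k ∈ W := by
    intro k
    have h1 : v [] k = ∑ i, C k i • ∑ j, E i j • v [] j := by
      simp only [Finset.smul_sum, smul_smul]
      rw [Finset.sum_comm]
      simp only [← Finset.sum_smul]
      have h2 : ∀ j, ∑ i, C k i * E i j = (1 : Matrix (Fin d) (Fin d) ℂ) k j := by
        intro j; rw [← hC, Matrix.mul_apply]
      simp [h2, Matrix.one_apply]
    rw [h1]
    exact W.sum_mem fun i _ => W.smul_mem _ (hrel i)
  have hF0 : F = 0 := by
    apply family_zero
    rintro ⟨b, k⟩
    have h1 := W.sub_mem (hbase k) (hall b.1 k b.2)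
    rw [sub_sub_cancel] at h1
    exact h1
  ext ⟨x, k⟩
  have h1 : F (x, (⟨[], hBnil⟩, k)) = 0 := by rw [hF0]; rfl
  rw [hF, hnil] at h1
  exact h1

theorem alg_of_not_unit {d : ℕ} (M : Matrix (Fin d) (Fin d) ℂ)
    (hM : ∀ i j, IsAlgebraic ℚ (M i j)) (lam : ℂ)
    (h : ¬ IsUnit (M - lam • (1 : Matrix (Fin d) (Fin d) ℂ))) : IsAlgebraic ℚ lam := by
  let E := algebraicClosure ℚ ℂ
  let M' : Matrix (Fin d) (Fin d) E := fun i j => ⟨M i j, mem_algebraicClosure_iff.2 (hM i j)⟩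
  have hMM : M = M'.map (algebraMap E ℂ) := rfl
  have h1 : IsAlgebraic E lam := by
    refine ⟨M'.charpoly, M'.charpoly_monic.ne_zero, ?_⟩
    rw [Polynomial.aeval_def, ← Polynomial.eval_map, ← Matrix.charpoly_map]
    rw [Matrix.isUnit_iff_isUnit_det, isUnit_iff_ne_zero, not_not] at h
    change (M.charpoly).eval lam = 0
    rw [Matrix.eval_charpoly]
    have h2 : Matrix.scalar (Fin d) lam - M = - (M - lam • (1 : Matrix (Fin d) (Fin d) ℂ)) := by
      rw [neg_sub, Matrix.smul_one_eq_diagonal]; rfl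
    rw [h2, Matrix.det_neg, h, mul_zero]
  have : Algebra.IsAlgebraic ℚ E := algebraicClosure.isAlgebraic ℚ ℂ
  exact h1.restrictScalars ℚ

end reduction

end FreeEig

/-- Free groups have the algebraic eigenvalue property. -/
theorem freeGroup_algebraic_eigenvalue_property (α : Type*) :
    HasAlgebraicEigenvalueProperty (FreeGroup α) := by
  intro d _ A hA T hT lam f hf0 hTf
  apply FreeEig.alg_of_not_unit (∑ g ∈ A.support, A g)
  · intro i j
    rw [Matrix.sum_apply]
    exact Finset.sum_induction _ (IsAlgebraic ℚ) (fun _ _ => IsAlgebraic.add) isAlgebraic_zero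
      (fun g _ => hA g i j)
  · intro hu
    apply hf0
    apply FreeEig.eig_zero A lam f _ hu
    intro x i
    rw [← hT f x i, hTf]
    rfl
end

section
/- Every amenable group has the algebraic eigenvalue property: if G is amenable, d ≥ 1, and A ∈ M_d(ℚ̄G), then every eigenvalue of A acting on ℓ²(G;ℂ^d) — i.e. every λ ∈ ℂ for which there exists a nonzero f ∈ ℓ²(G;ℂ^d) with Af = λf — is algebraic over ℚ. -/
set_option synthInstance.maxHeartbeats 1000000
set_option maxHeartbeats 1000000

noncomputable section

open scoped Pointwise

/-- `G` is amenable in the sense of the Følner condition: every finite subset `Z ⊆ G` and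
`ε > 0` admit a nonempty finite subset `X ⊆ G` with `|ZX \ X| < ε |X|`. -/
def FolnerAmenable (G : Type*) [Group G] : Prop :=
  ∀ (Z : Finset G) (ε : ℝ), 0 < ε →
    ∃ X : Finset G, X.Nonempty ∧
      letI := Classical.decEq G
      ((Z * X) \ X).card < ε * X.card


theorem aux_alg {N : Type*} [Fintype N] [DecidableEq N] (B : Matrix N N ℂ)
    (hB : ∀ i j, IsAlgebraic ℚ (B i j)) (lam : ℂ) (hl : ¬ IsAlgebraic ℚ lam) :
    (Matrix.scalar N lam - B).det ≠ 0 := by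
  intro h
  apply hl
  let K := algebraicClosure ℚ ℂ
  let B' : Matrix N N K := fun i j => ⟨B i j, mem_algebraicClosure_iff.2 (hB i j)⟩
  have hm : B = B'.map (algebraMap K ℂ) := by ext i j; rfl
  have : IsAlgebraic K lam := by
    refine ⟨B'.charpoly, B'.charpoly_monic.ne_zero, ?_⟩
    rw [← Matrix.eval_charpoly, hm, Matrix.charpoly_map, Polynomial.eval_map_algebraMap] at h
    exact h
  have : Algebra.IsAlgebraic ℚ K := algebraicClosure.isAlgebraic ℚ ℂ
  exact IsAlgebraic.restrictScalars (S := K) ℚ ‹_›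

theorem aux_card {G : Type*} [Group G] [DecidableEq G] (Z X : Finset G) :
    (X.filter (fun x => ¬ ∀ g ∈ Z, g⁻¹ * x ∈ X)).card ≤ Z.card * ((Z * X) \ X).card := by
  have h1 : X.filter (fun x => ¬ ∀ g ∈ Z, g⁻¹ * x ∈ X) ⊆
      Z.biUnion (fun z => X \ (z • X)) := by
    intro x hx
    simp only [Finset.mem_filter, not_forall] at hx
    obtain ⟨hx, g, hg, hgx⟩ := hx
    simp only [Finset.mem_biUnion, Finset.mem_sdiff]
    exact ⟨g, hg, hx, fun h => hgx (by simpa using Finset.inv_smul_mem_iff.2 h)⟩ 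
  refine (Finset.card_le_card h1).trans (Finset.card_biUnion_le_card_mul _ _ _ ?_)
  intro z hz
  have h2 : (X \ (z • X)).card = ((z • X) \ X).card :=
    Finset.card_sdiff_comm (by simp)
  rw [h2]
  apply Finset.card_le_card
  apply Finset.sdiff_subset_sdiff _ le_rfl
  exact Finset.smul_finset_subset_mul hz

theorem aux_shift {G : Type*} [Group G] {d : ℕ} (f : L2 G d) (h : G) :
    ∃ f' : L2 G d, (∀ x i, f' (x, i) = f (x * h, i)) ∧ ‖f'‖ = ‖f‖ := by
  have hp : 0 < (2 : ENNReal).toReal := by norm_num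
  let e : G × Fin d ≃ G × Fin d := (Equiv.mulRight h).prodCongr (Equiv.refl _)
  have hm : Memℓp (fun p => f (e p)) 2 := by
    rw [memℓp_gen_iff hp]
    exact ((memℓp_gen_iff hp).1 f.2).comp_injective e.injective
  refine ⟨⟨fun p => f (e p), hm⟩, fun x i => rfl, ?_⟩
  rw [lp.norm_eq_tsum_rpow hp, lp.norm_eq_tsum_rpow hp]
  congr 1
  exact e.tsum_eq (fun p => ‖f p‖ ^ (2 : ENNReal).toReal)

theorem aux_trace {I N : Type*} [DecidableEq I] [Fintype N] [DecidableEq N] (ι : N → I)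
    (hι : Function.Injective ι)
    (K : Submodule ℂ (lp (fun _ : I => ℂ) 2)) [K.HasOrthogonalProjection]
    (M : Matrix N N ℂ)
    (hM : ∀ p q, M p q = K.starProjection (lp.single 2 (ι q) (1 : ℂ)) (ι p)) :
    M.trace.re ≤ M.rank := by
  have hMi : ∀ p q, M p q = inner ℂ (lp.single 2 (ι p) (1 : ℂ))
      (K.starProjection (lp.single 2 (ι q) (1 : ℂ))) := by
    intro p q
    rw [lp.inner_single_left, hM]; simp
  have hH : M.IsHermitian := by
    ext p q
    rw [Matrix.conjTranspose_apply, hMi, hMi, ← Submodule.inner_starProjection_left_eq_right]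
    exact inner_conj_symm _ _
  have hle : ∀ k, hH.eigenvalues k ≤ 1 := by
    intro k
    set v : N → ℂ := ⇑(hH.eigenvectorBasis k) with hv
    have hev := hH.mulVec_eigenvectorBasis k
    rw [← hv] at hev
    have hn : ∑ p, starRingEnd ℂ (v p) * v p = 1 := by
      have := hH.eigenvectorBasis.orthonormal.1 k
      have h2 : inner ℂ (hH.eigenvectorBasis k) (hH.eigenvectorBasis k) = (1 : ℂ) := by
        rw [inner_self_eq_norm_sq_to_K, this]; simp
      rw [PiLp.inner_apply] at h2
      rw [← h2]
      exact Finset.sum_congr rfl fun p _ => by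
        rw [RCLike.inner_apply, mul_comm]
    let u : lp (fun _ : I => ℂ) 2 := ∑ q, v q • lp.single 2 (ι q) (1 : ℂ)
    have hin : ∀ w : lp (fun _ : I => ℂ) 2,
        inner ℂ u w = ∑ p, starRingEnd ℂ (v p) * w (ι p) := by
      intro w
      simp only [u, sum_inner, inner_smul_left, lp.inner_single_left]
      simp
    have hu : ∀ p, u (ι p) = v p := by
      intro p
      have : inner ℂ (lp.single 2 (ι p) (1 : ℂ)) u = v p := by
        simp only [u, inner_sum, inner_smul_right, lp.inner_single_left]
        simp [lp.single_apply, Pi.single_apply, hι.eq_iff]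
      rw [lp.inner_single_left] at this
      simpa using this
    have hPu : ∀ p, K.starProjection u (ι p) = hH.eigenvalues k * v p := by
      intro p
      have : inner ℂ (lp.single 2 (ι p) (1 : ℂ)) (K.starProjection u) = (M.mulVec v) p := by
        simp only [u, map_sum, map_smul, inner_sum, inner_smul_right, ← hMi]
        simp [Matrix.mulVec, dotProduct, mul_comm]
      rw [lp.inner_single_left, hev] at this
      simpa using this
    have huu : ‖u‖ = 1 := by
      have h1 : inner ℂ u u = (1 : ℂ) := by rw [hin]; simp only [hu, hn]
      rw [inner_self_eq_norm_sq_to_K] at h1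
      have h2 : ‖u‖ ^ 2 = 1 := by
        have h1' : ((‖u‖ ^ 2 : ℝ) : ℂ) = ((1 : ℝ) : ℂ) := by push_cast; exact h1
        exact Complex.ofReal_injective h1'
      nlinarith [norm_nonneg u]
    have huP : inner ℂ u (K.starProjection u) = (hH.eigenvalues k : ℂ) := by
      rw [hin]; simp only [hPu]
      calc _ = (hH.eigenvalues k : ℂ) * ∑ p, starRingEnd ℂ (v p) * v p := by
            rw [Finset.mul_sum]
            exact Finset.sum_congr rfl fun p _ => by ring
        _ = _ := by rw [hn, mul_one]
    have h3 := norm_inner_le_norm (𝕜 := ℂ) u (K.starProjection u)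
    rw [huP, huu, one_mul] at h3
    have h4 := K.norm_starProjection_apply_le u
    rw [huu] at h4
    have h5 := Complex.re_le_norm (hH.eigenvalues k : ℂ)
    rw [Complex.ofReal_re] at h5
    linarith
  rw [hH.trace_eq_sum_eigenvalues, hH.rank_eq_card_non_zero_eigs, Fintype.card_subtype,
    Finset.card_filter]
  push_cast
  rw [Complex.re_sum]
  refine Finset.sum_le_sum fun k _ => ?_
  split_ifs with h
  · simpa using hle k
  · simp at h; simp [h]

/-- Every amenable group has the algebraic eigenvalue property. -/
theorem amenable_algebraic_eigenvalue_property
    (G : Type*) [Group G] (hG : FolnerAmenable G) :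
    HasAlgebraicEigenvalueProperty G := by
  classical
  intro d hd A hA T hT lam f hf hTf
  by_contra hlam
  obtain ⟨⟨y, i0⟩, hy⟩ : ∃ p, f p ≠ 0 := by
    by_contra! h
    exact hf (lp.ext (funext h))
  have hfn : 0 < ‖f‖ := norm_pos_iff.2 hf
  let K : Submodule ℂ (L2 G d) := LinearMap.ker (T - lam • ContinuousLinearMap.id ℂ _).toLinearMap
  have hKmem : ∀ w, w ∈ K ↔ T w = lam • w := by
    intro w
    simp [K, sub_eq_zero]
  have hKc : IsClosed (K : Set (L2 G d)) :=
    ContinuousLinearMap.isClosed_ker (T - lam • ContinuousLinearMap.id ℂ _)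
  have : CompleteSpace K := hKc.completeSpace_coe
  let c : ℝ := (‖f (y, i0)‖ / ‖f‖) ^ 2
  have hc : 0 < c := by have := norm_pos_iff.2 hy; positivity
  -- diagonal entries
  have hdiag : ∀ p : G × Fin d, 0 ≤ (K.starProjection (lp.single 2 p (1 : ℂ)) p).re := by
    intro p
    have h1 := K.re_inner_starProjection_nonneg (lp.single 2 p (1 : ℂ))
    rw [lp.inner_single_right] at h1
    simpa using h1
  have hdiag' : ∀ x : G, c ≤ (K.starProjection (lp.single 2 (x, i0) (1 : ℂ)) (x, i0)).re := by
    intro x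
    obtain ⟨f', hf', hn⟩ := aux_shift f (x⁻¹ * y)
    have hK : f' ∈ K := by
      rw [hKmem]
      ext ⟨z, i⟩
      have h1 := hT f (z * (x⁻¹ * y)) i
      rw [hTf] at h1
      rw [hT, lp.coeFn_smul, Pi.smul_apply, hf']
      rw [lp.coeFn_smul, Pi.smul_apply] at h1
      rw [h1]
      simp only [hf', mul_assoc]
    have h1 := K.re_inner_starProjection_eq_normSq (lp.single 2 (x, i0) (1 : ℂ))
    rw [lp.inner_single_right] at h1
    have h2 : (K.starProjection (lp.single 2 (x, i0) (1 : ℂ)) (x, i0)).re =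
        ‖K.starProjection (lp.single 2 (x, i0) (1 : ℂ))‖ ^ 2 := by
      simpa using h1
    rw [h2]
    have h3 : inner ℂ (K.starProjection (lp.single 2 (x, i0) (1 : ℂ))) f' = f (y, i0) := by
      rw [Submodule.inner_starProjection_left_eq_right,
        Submodule.starProjection_eq_self_iff.2 hK, lp.inner_single_left, hf']
      simp
    have h4 := norm_inner_le_norm (𝕜 := ℂ) (K.starProjection (lp.single 2 (x, i0) (1 : ℂ))) f'
    rw [h3, hn] at h4
    have h5 : ‖f (y, i0)‖ / ‖f‖ ≤ ‖K.starProjection (lp.single 2 (x, i0) (1 : ℂ))‖ := by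
      rwa [div_le_iff₀ hfn]
    exact pow_le_pow_left₀ (by positivity) h5 2
  obtain ⟨ε, hε, h7⟩ : ∃ ε : ℝ, 0 < ε ∧ c = ε * (d * A.support.card + 1) :=
    ⟨c / (d * A.support.card + 1), by positivity, by
      rw [div_mul_cancel₀]; positivity⟩
  obtain ⟨X, hXne, hX⟩ := hG A.support ε hε
  have hX' : ((((A.support * X) \ X).card : ℕ) : ℝ) < ε * X.card := by
    convert hX
  let ι : X × Fin d → G × Fin d := fun p => (p.1, p.2)
  have hι : Function.Injective ι := by
    rintro ⟨⟨a, ha⟩, i⟩ ⟨⟨b, hb⟩, j⟩ h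
    simp only [ι, Prod.mk.injEq] at h
    obtain ⟨rfl, rfl⟩ := h
    rfl
  let M : Matrix (X × Fin d) (X × Fin d) ℂ :=
    fun p q => K.starProjection (lp.single 2 (ι q) (1 : ℂ)) (ι p)
  have htr := aux_trace ι hι K M (fun p q => rfl)
  have htr2 : c * X.card ≤ M.trace.re := by
    rw [Matrix.trace, Complex.re_sum, Fintype.sum_prod_type]
    have : ∀ x : X, c ≤ ∑ i : Fin d, (M.diag (x, i)).re := fun x =>
      (hdiag' x).trans (Finset.single_le_sum (f := fun i => (M.diag (x, i)).re)
        (fun i _ => hdiag (x, i)) (Finset.mem_univ i0))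
    calc c * X.card = ∑ x : X, c := by simp [mul_comm]
      _ ≤ _ := Finset.sum_le_sum fun x _ => this x
  let B : Matrix (X × Fin d) (X × Fin d) ℂ := fun p q => A (p.1 * (q.1 : G)⁻¹) p.2 q.2
  have hdet := aux_alg B (fun p q => hA _ _ _) lam hlam
  let C := Matrix.scalar (X × Fin d) lam - B
  let bad : Finset G := X.filter (fun x => ¬ ∀ g ∈ A.support, g⁻¹ * x ∈ X)
  let S : Finset (X × Fin d) := Finset.univ.filter (fun p => (p.1 : G) ∈ bad)
  have hScard : S.card ≤ bad.card * d := by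
    calc S.card = (S.image ι).card := (Finset.card_image_of_injective _ hι).symm
      _ ≤ (bad ×ˢ (Finset.univ : Finset (Fin d))).card := by
        apply Finset.card_le_card
        intro p hp
        obtain ⟨q, hq, rfl⟩ := Finset.mem_image.1 hp
        simpa [S, ι] using hq
      _ = _ := by simp
  have hrow : ∀ p, p ∉ S → (C * M) p = 0 := by
    rintro ⟨⟨x, hx⟩, i⟩ hp
    have hgood : ∀ g ∈ A.support, g⁻¹ * x ∈ X := by
      by_contra h
      exact hp (by simp only [S, bad, Finset.mem_filter, Finset.mem_univ, true_and]; exact ⟨hx, h⟩)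
    ext q
    have hw := (hKmem _).1 (K.starProjection_apply_mem (lp.single 2 (ι q) (1 : ℂ)))
    set w := K.starProjection (lp.single 2 (ι q) (1 : ℂ)) with hwdef
    have h1 := hT w x i
    rw [hw, lp.coeFn_smul, Pi.smul_apply, smul_eq_mul] at h1
    have h2 : (B * M) (⟨x, hx⟩, i) q = lam * w (x, i) := by
      rw [h1, Matrix.mul_apply, Fintype.sum_prod_type]
      change ∑ z : X, ∑ j : Fin d, A (x * (z : G)⁻¹) i j * w (z, j) = _
      rw [Finset.sum_coe_sort X (fun z => ∑ j : Fin d, A (x * (z : G)⁻¹) i j * w (z, j))]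
      symm
      apply Finset.sum_bij_ne_zero (fun g _ _ => g⁻¹ * x)
      · intro g hg _; exact hgood g hg
      · intro a _ _ b _ _ h; simpa using h
      · intro z hz hne
        refine ⟨x * z⁻¹, ?_, ?_, by group⟩
        · rw [Finsupp.mem_support_iff]
          intro h0
          apply hne
          simp [h0]
        · simpa [mul_assoc] using hne
      · intro g hg _
        simp
    change ((Matrix.scalar (X × Fin d) lam - B) * M) _ q = 0
    rw [Matrix.sub_mul, Matrix.sub_apply, h2, Matrix.scalar_apply, Matrix.diagonal_mul]
    exact sub_self _
  have hrank : M.rank ≤ S.card := by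
    rw [← Matrix.rank_mul_eq_right_of_det_ne_zero C M hdet]
    refine Matrix.rank_le_card_of_support_subset _ _ ?_
    rw [Function.support_subset_iff']
    exact fun p hp => hrow p (by simpa using hp)
  have hbad := aux_card A.support X
  have hfin : (M.rank : ℝ) ≤ d * A.support.card * ((A.support * X) \ X).card := by
    have : M.rank ≤ d * A.support.card * ((A.support * X) \ X).card := by
      calc M.rank ≤ bad.card * d := hrank.trans hScard
        _ ≤ (A.support.card * ((A.support * X) \ X).card) * d := Nat.mul_le_mul_right _ hbad
        _ = _ := by ring
    exact_mod_cast this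
  have hXpos : (0 : ℝ) < X.card := by exact_mod_cast hXne.card_pos
  have h6 : c * X.card ≤ d * A.support.card * (ε * X.card) :=
    htr2.trans (htr.trans (hfin.trans (mul_le_mul_of_nonneg_left hX'.le (by positivity))))
  have : 0 < ε * X.card := by positivity
  rw [h7] at h6
  nlinarith

end
end

section
/- Let G be a residually finite group, d ≥ 1, and A ∈ M_d(ℚ̄G) with A = A*, where A* is the adjoint matrix. Let λ ∈ ℝ be a Liouville transcendental number, i.e. for every n ∈ ℕ there exist integers p_n, q_n with q_n ≥ 2 and 0 < |λ − p_n/q_n| ≤ q_n^{−n}. Then λ is not an eigenvalue of A acting on ℓ²(G;ℂ^d): there is no nonzero f ∈ ℓ²(G;ℂ^d) with Af = λf. -/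
set_option synthInstance.maxHeartbeats 1000000
set_option maxHeartbeats 1000000

noncomputable section

section aux1
open MonoidAlgebra

def rhoM {d : ℕ} (X : Type*) :
    Matrix (Fin d) (Fin d) ℂ →ₐ[ℂ] Module.End ℂ (X × Fin d → ℂ) where
  toFun M :=
    { toFun := fun v p => ∑ j, M p.2 j * v (p.1, j)
      map_add' := by intro v w; ext p; simp [mul_add, Finset.sum_add_distrib]
      map_smul' := by
        intro c v; ext p; simp only [Pi.smul_apply, smul_eq_mul, RingHom.id_apply, Finset.mul_sum]
        exact Finset.sum_congr rfl fun j _ => by ring }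
  map_one' := by
    apply LinearMap.ext; intro v; ext p
    simp [Matrix.one_apply]
  map_mul' := by
    intro M N; apply LinearMap.ext; intro v; ext p
    simp only [Matrix.mul_apply, Finset.sum_mul, LinearMap.coe_mk, AddHom.coe_mk,
      Module.End.mul_apply, Finset.mul_sum]
    rw [Finset.sum_comm]
    exact Finset.sum_congr rfl fun j _ => Finset.sum_congr rfl fun k _ => by ring
  map_zero' := by apply LinearMap.ext; intro v; ext p; simp
  map_add' := by
    intro M N; apply LinearMap.ext; intro v; ext p; simp [add_mul, Finset.sum_add_distrib]
  commutes' := by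
    intro c; apply LinearMap.ext; intro v; ext p
    simp [Matrix.algebraMap_matrix_apply, Module.algebraMap_end_apply]

def rhoG {G : Type*} [Group G] {d : ℕ} (X : Type*) [MulAction G X] :
    G →* Module.End ℂ (X × Fin d → ℂ) where
  toFun h :=
    { toFun := fun v p => v (h⁻¹ • p.1, p.2)
      map_add' := by intro v w; ext p; simp
      map_smul' := by intro c v; ext p; simp }
  map_one' := by apply LinearMap.ext; intro v; ext p; simp
  map_mul' := by
    intro g h; apply LinearMap.ext; intro v; ext p; simp [mul_smul]

lemma rho_comm {G : Type*} [Group G] {d : ℕ} (X : Type*) [MulAction G X]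
    (M : Matrix (Fin d) (Fin d) ℂ) (g : G) :
    Commute (rhoM X M) (rhoG X g : Module.End ℂ (X × Fin d → ℂ)) := by
  apply LinearMap.ext; intro v; ext p
  simp [rhoM, rhoG]

def rho {G : Type*} [Group G] {d : ℕ} (X : Type*) [MulAction G X] :
    MonoidAlgebra (Matrix (Fin d) (Fin d) ℂ) G →ₐ[ℂ] Module.End ℂ (X × Fin d → ℂ) :=
  MonoidAlgebra.liftNCAlgHom (rhoM X) (rhoG X) (rho_comm X)

lemma rho_single {G : Type*} [Group G] {d : ℕ} (X : Type*) [MulAction G X] (g : G)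
    (M : Matrix (Fin d) (Fin d) ℂ) (v : X × Fin d → ℂ) (p : X × Fin d) :
    rho X (single g M) v p = ∑ j, M p.2 j * v (g⁻¹ • p.1, j) := by
  rw [rho, coe_liftNCAlgHom, liftNC_single]
  simp [rhoM, rhoG]

lemma rho_apply {G : Type*} [Group G] {d : ℕ} (X : Type*) [MulAction G X]
    (B : MonoidAlgebra (Matrix (Fin d) (Fin d) ℂ) G) (v : X × Fin d → ℂ) (p : X × Fin d) :
    rho X B v p = ∑ g ∈ B.coeff.support, ∑ j, B.coeff g p.2 j * v (g⁻¹ • p.1, j) := by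
  have h : B = ∑ g ∈ B.coeff.support, single g (B.coeff g) := by
    apply coeff_injective
    rw [coeff_sum]
    exact (Finsupp.sum_single B.coeff).symm
  conv_lhs => rw [h]
  rw [map_sum, LinearMap.sum_apply, Finset.sum_apply]
  exact Finset.sum_congr rfl fun g _ => rho_single X g _ v p

lemma single_mul_single_comm1 {G : Type*} [Group G] {d : ℕ}
    (x : Matrix (Fin d) (Fin d) ℂ) (y : G) :
    (single (1:G) x : MonoidAlgebra (Matrix (Fin d) (Fin d) ℂ) G) * single y 1
      = single y 1 * single 1 x := by
  simp [single_mul_single]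

def stH (G : Type*) [Group G] (d : ℕ) :
    MonoidAlgebra (Matrix (Fin d) (Fin d) ℂ) G →+*
      (MonoidAlgebra (Matrix (Fin d) (Fin d) ℂ) G)ᵐᵒᵖ :=
  MonoidAlgebra.liftNCRingHom
    { toFun := fun M => MulOpposite.op (single 1 M.conjTranspose)
      map_one' := by simp [one_def]
      map_mul' := by
        intro M N; rw [← MulOpposite.op_mul, single_mul_single, Matrix.conjTranspose_mul]; simp
      map_zero' := by simp
      map_add' := by intro M N; simp [single_add] }
    { toFun := fun g => MulOpposite.op (single g⁻¹ 1)
      map_one' := by simp [one_def]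
      map_mul' := by
        intro M N; rw [← MulOpposite.op_mul, single_mul_single]; simp }
    (by
      intro x y
      change _ * _ = _ * _
      simp only [RingHom.coe_mk, MonoidHom.coe_mk, OneHom.coe_mk, ← MulOpposite.op_mul]
      rw [single_mul_single_comm1])

def st {G : Type*} [Group G] {d : ℕ} (B : MonoidAlgebra (Matrix (Fin d) (Fin d) ℂ) G) :
    MonoidAlgebra (Matrix (Fin d) (Fin d) ℂ) G := (stH G d B).unop

lemma st_single {G : Type*} [Group G] {d : ℕ} (g : G) (M : Matrix (Fin d) (Fin d) ℂ) :
    st (single g M) = single g⁻¹ M.conjTranspose := by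
  rw [st, stH, liftNCRingHom_single]
  simp [single_mul_single]

lemma st_coeff {G : Type*} [Group G] {d : ℕ}
    (B : MonoidAlgebra (Matrix (Fin d) (Fin d) ℂ) G) (g : G) :
    (st B).coeff g = (B.coeff g⁻¹).conjTranspose := by
  classical
  have h : B = ∑ g ∈ B.coeff.support, single g (B.coeff g) := by
    apply coeff_injective
    rw [coeff_sum]
    exact (Finsupp.sum_single B.coeff).symm
  have h2 : st B = ∑ g ∈ B.coeff.support, single g⁻¹ (B.coeff g).conjTranspose := by
    conv_lhs => rw [h]
    rw [st, map_sum, Finset.unop_sum]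
    exact Finset.sum_congr rfl fun g _ => st_single _ _
  rw [h2, coeff_sum, Finset.sum_apply']
  simp only [coeff_single, Finsupp.single_apply, inv_eq_iff_eq_inv]
  rw [Finset.sum_ite_eq']
  split_ifs with h3
  · rfl
  · rw [Finsupp.notMem_support_iff.mp h3]; simp

lemma st_aeval {G : Type*} [Group G] {d : ℕ}
    (A : MonoidAlgebra (Matrix (Fin d) (Fin d) ℂ) G) (hA : st A = A) (Q : Polynomial ℝ) :
    st (Polynomial.aeval A (Q.map (algebraMap ℝ ℂ))) =
      Polynomial.aeval A (Q.map (algebraMap ℝ ℂ)) := by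
  have hA' : stH G d A = MulOpposite.op A := by
    rw [← MulOpposite.unop_inj]; exact hA
  rw [st]
  induction Q using Polynomial.induction_on' with
  | add p q hp hq => simp only [Polynomial.map_add, map_add, MulOpposite.unop_add, hp, hq]
  | monomial n a =>
    simp only [Polynomial.map_monomial, Polynomial.aeval_monomial, map_mul, map_pow, hA',
      MulOpposite.unop_mul, MulOpposite.unop_pow, MulOpposite.unop_op]
    have : (stH G d (algebraMap ℂ _ (algebraMap ℝ ℂ a))).unop = 
      algebraMap ℂ (MonoidAlgebra (Matrix (Fin d) (Fin d) ℂ) G) (algebraMap ℝ ℂ a) := by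
      have := st_single (1:G) (algebraMap ℂ (Matrix (Fin d) (Fin d) ℂ) (algebraMap ℝ ℂ a))
      rw [st] at this
      simp only [coe_algebraMap, Function.comp]
      rw [this]
      congr 1
      · simp
      · ext i j
        simp [Matrix.algebraMap_matrix_apply, Matrix.conjTranspose_apply, apply_ite star, eq_comm]
    rw [this]
    exact (Algebra.commutes _ _).symm

lemma mul_coeff_one {G : Type*} [Group G] {d : ℕ}
    (B C : MonoidAlgebra (Matrix (Fin d) (Fin d) ℂ) G) :
    (B * C).coeff 1 = ∑ g ∈ C.coeff.support, B.coeff g⁻¹ * C.coeff g := by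
  have h : C = ∑ g ∈ C.coeff.support, single g (C.coeff g) := by
    apply coeff_injective
    rw [coeff_sum]
    exact (Finsupp.sum_single C.coeff).symm
  conv_lhs => rw [h]
  rw [Finset.mul_sum, coeff_sum, Finset.sum_apply']
  refine Finset.sum_congr rfl fun g _ => ?_
  rw [coeff_mul_single_apply]
  simp

lemma lower_bound {G : Type*} [Group G] {d : ℕ}
    (B : MonoidAlgebra (Matrix (Fin d) (Fin d) ℂ) G) (hB : st B = B)
    (f : G × Fin d → ℂ) (F : ℝ) (hF : ∀ s : Finset (G × Fin d), ∑ p ∈ s, ‖f p‖ ^ 2 ≤ F)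
    (μ : ℂ) (hμ : rho G B f = μ • f) (i : Fin d) :
    ‖μ‖ ^ 2 * ‖f (1, i)‖ ^ 2 ≤ F * ((B * B).coeff 1 i i).re := by
  classical
  have hs : ∀ g, B.coeff g⁻¹ = (B.coeff g).conjTranspose := by
    intro g; conv_lhs => rw [← hB]
    rw [st_coeff, inv_inv]
  have h1 : ((B * B).coeff 1 i i).re =
      ∑ p ∈ B.coeff.support ×ˢ (Finset.univ : Finset (Fin d)), ‖B.coeff p.1 p.2 i‖ ^ 2 := by
    rw [mul_coeff_one, Matrix.sum_apply, Finset.sum_product, Complex.re_sum]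
    refine Finset.sum_congr rfl fun g _ => ?_
    rw [hs, Matrix.mul_apply, Complex.re_sum]
    refine Finset.sum_congr rfl fun k _ => ?_
    rw [Matrix.conjTranspose_apply, RCLike.star_def, mul_comm, Complex.mul_conj,
      Complex.normSq_eq_norm_sq]
    exact Complex.ofReal_re _
  have hsupp : ∀ g ∈ B.coeff.support, g⁻¹ ∈ B.coeff.support := by
    intro g hg
    rw [Finsupp.mem_support_iff] at hg ⊢
    rw [hs]; simpa using hg
  have h2 : μ * f (1, i) =
      ∑ p ∈ B.coeff.support ×ˢ (Finset.univ : Finset (Fin d)),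
        star (B.coeff p.1 p.2 i) * f p := by
    have := congrFun hμ (1, i)
    rw [rho_apply] at this
    simp only [Pi.smul_apply, smul_eq_mul, mul_one] at this
    rw [← this, Finset.sum_product]
    refine Finset.sum_bij' (fun g _ => g⁻¹) (fun g _ => g⁻¹) hsupp hsupp (by simp) (by simp) ?_
    intro g _
    refine Finset.sum_congr rfl fun k _ => ?_
    rw [hs]; simp
  have h3 : ‖μ * f (1, i)‖ ≤ ∑ p ∈ B.coeff.support ×ˢ (Finset.univ : Finset (Fin d)),
        ‖B.coeff p.1 p.2 i‖ * ‖f p‖ := by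
    rw [h2]
    refine (norm_sum_le _ _).trans (le_of_eq ?_)
    refine Finset.sum_congr rfl fun p _ => by rw [norm_mul, norm_star]
  rw [← mul_pow, ← norm_mul, h1]
  calc ‖μ * f (1, i)‖ ^ 2 ≤ _ := pow_le_pow_left₀ (norm_nonneg _) h3 2
    _ ≤ _ := Finset.sum_mul_sq_le_sq_mul_sq _ _ _
    _ ≤ _ := by
      rw [mul_comm]
      exact mul_le_mul_of_nonneg_right (hF _) (Finset.sum_nonneg fun _ _ => by positivity)

lemma trace_rho {G : Type*} [Group G] {d : ℕ} (N : Subgroup G) [N.Normal] [Fintype (G ⧸ N)]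
    [DecidableEq (G ⧸ N)]
    (B : MonoidAlgebra (Matrix (Fin d) (Fin d) ℂ) G)
    (hN : ∀ g ∈ B.coeff.support, g ≠ 1 → g ∉ N) :
    (LinearMap.toMatrix' (rho (G ⧸ N) B)).trace =
      (Fintype.card (G ⧸ N) : ℂ) * ∑ i, B.coeff 1 i i := by
  classical
  have key : ∀ p : (G ⧸ N) × Fin d,
      rho (G ⧸ N) B (Pi.single p 1) p = B.coeff 1 p.2 p.2 := by
    rintro ⟨x, i⟩
    rw [rho_apply]
    have : ∀ g ∈ B.coeff.support, g ≠ 1 → 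
      ∑ j, B.coeff g i j * (Pi.single (x, i) 1 : (G ⧸ N) × Fin d → ℂ) (g⁻¹ • x, j) = 0 := by
      intro g hg hg1
      refine Finset.sum_eq_zero fun j _ => ?_
      rw [Pi.single_apply, if_neg, mul_zero]
      intro h
      have hx : g⁻¹ • x = x := congrArg Prod.fst h
      induction x using QuotientGroup.induction_on with
      | H y =>
      have : ((g⁻¹ * y : G) : G ⧸ N) = y := hx
      rw [QuotientGroup.eq] at this
      have h5 : y⁻¹ * g * y ∈ N := by simpa [mul_assoc] using this
      have h4 := Subgroup.Normal.conj_mem ‹N.Normal› _ h5 y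
      apply hN g hg hg1
      simpa [mul_assoc] using h4
    by_cases h1 : (1:G) ∈ B.coeff.support
    · rw [Finset.sum_eq_single_of_mem 1 h1 this]
      simp [Pi.single_apply]
    · rw [Finset.sum_eq_zero, Finsupp.notMem_support_iff.mp h1]
      · simp
      · intro g hg
        exact this g hg (fun h => h1 (h ▸ hg))
  rw [Matrix.trace]
  simp only [Matrix.diag_apply, LinearMap.toMatrix'_apply]
  rw [Finset.sum_congr rfl fun p _ => key p, Fintype.sum_prod_type]
  simp

end aux1


section aux2
open Polynomial

lemma row_root {n : Type*} [Fintype n] [DecidableEq n] (M : Matrix n n ℂ) (R : ℝ)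
    (h : ∀ i, ∑ j, ‖M i j‖ ≤ R) (z : ℂ) (hz : z ∈ M.charpoly.roots) : ‖z‖ ≤ R := by
  have h1 : IsRoot M.charpoly z := isRoot_of_mem_roots hz
  have h2 : Module.End.HasEigenvalue (Matrix.toLin' M) z := by
    rw [Module.End.hasEigenvalue_iff_isRoot_charpoly, Matrix.charpoly_toLin']
    exact h1
  obtain ⟨k, hk⟩ := eigenvalue_mem_ball h2
  rw [mem_closedBall_iff_norm] at hk
  calc ‖z‖ ≤ ‖M k k‖ + ‖z - M k k‖ := by
        have := norm_add_le (M k k) (z - M k k); simpa using this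
    _ ≤ ‖M k k‖ + ∑ j ∈ Finset.univ.erase k, ‖M k j‖ := by linarith
    _ = ∑ j, ‖M k j‖ := Finset.add_sum_erase _ (fun j => ‖M k j‖) (Finset.mem_univ k)
    _ ≤ R := h k

lemma coeff_bound {n : Type*} [Fintype n] [DecidableEq n] (M : Matrix n n ℂ) (R : ℝ) (hR : 1 ≤ R)
    (h : ∀ i, ∑ j, ‖M i j‖ ≤ R) (k : ℕ) :
    ‖M.charpoly.coeff k‖ ≤ (2 * R) ^ Fintype.card n := by
  have := coeff_le_of_roots_le (f := RingHom.id ℂ) (p := M.charpoly) (B := R) k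
    (Matrix.charpoly_monic M) (IsAlgClosed.splits _) (by
      rw [Polynomial.map_id]; exact row_root M R h)
  rw [Polynomial.map_id, Matrix.charpoly_natDegree_eq_dim] at this
  refine this.trans ?_
  rw [mul_pow, mul_comm]
  gcongr
  · exact_mod_cast Nat.choose_le_two_pow _ _
  · exact Nat.sub_le _ _

lemma trailing_prod {n : Type*} (s : Finset n) (e : n → ℂ) :
    ‖(∏ i ∈ s, (X - C (e i))).trailingCoeff‖ = ∏ i ∈ s, if e i = 0 then 1 else ‖e i‖ := by
  classical
  induction s using Finset.induction_on with
  | empty => 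
    simp only [Finset.prod_empty]
    simp [trailingCoeff]
  | insert a s ha ih =>
    rw [Finset.prod_insert ha, Finset.prod_insert ha, trailingCoeff_mul, norm_mul, ih]
    congr 1
    split_ifs with h
    · simp [h, trailingCoeff]
    · have : (X - C (e a)).coeff 0 ≠ 0 := by simpa using h
      rw [trailingCoeff, natTrailingDegree_eq_zero.mpr (Or.inr this)]; simp

lemma herm_aeval {n : Type*} [Fintype n] [DecidableEq n] (M : Matrix n n ℂ) (hM : M.IsHermitian)
    (Q : Polynomial ℂ) :
    aeval M Q = Unitary.conjStarAlgAut ℂ _ hM.eigenvectorUnitary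
      (Matrix.diagonal fun i => Q.eval (hM.eigenvalues i : ℂ)) := by
  have h : aeval (Matrix.diagonal ((RCLike.ofReal : ℝ → ℂ) ∘ hM.eigenvalues)) Q =
      Matrix.diagonal fun i => Q.eval (hM.eigenvalues i : ℂ) := by
    have := Polynomial.aeval_algHom_apply (Matrix.diagonalAlgHom (n := n) (α := ℂ) ℂ)
      ((RCLike.ofReal : ℝ → ℂ) ∘ hM.eigenvalues) Q
    refine Eq.trans this ?_
    change Matrix.diagonal _ = _
    congr 1
    ext i
    have := Polynomial.aeval_algHom_apply (Pi.evalAlgHom ℂ (fun _ : n => ℂ) i)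
      ((RCLike.ofReal : ℝ → ℂ) ∘ hM.eigenvalues) Q
    refine Eq.trans this.symm ?_
    simp [Polynomial.aeval_def, Polynomial.eval₂_eq_eval_map]
  rw [← h]
  conv_lhs => rw [hM.spectral_theorem]
  exact Polynomial.aeval_algHom_apply (Unitary.conjStarAlgAut ℂ (Matrix n n ℂ) hM.eigenvectorUnitary : Matrix n n ℂ →⋆ₐ[ℂ] Matrix n n ℂ).toAlgHom _ Q

lemma herm_trace {n : Type*} [Fintype n] [DecidableEq n] (M : Matrix n n ℂ) (hM : M.IsHermitian)
    (Q : Polynomial ℂ) :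
    (aeval M Q).trace = ∑ i, Q.eval (hM.eigenvalues i : ℂ) := by
  rw [herm_aeval M hM Q, Unitary.conjStarAlgAut_apply, Matrix.trace_mul_comm, ← mul_assoc]
  simp [Matrix.trace_diagonal]

lemma herm_charpoly {n : Type*} [Fintype n] [DecidableEq n] (M : Matrix n n ℂ) (hM : M.IsHermitian)
    (Q : Polynomial ℂ) :
    (aeval M Q).charpoly = ∏ i, (X - C (Q.eval (hM.eigenvalues i : ℂ))) := by
  rw [herm_aeval M hM Q, Unitary.conjStarAlgAut_apply, Matrix.charpoly_mul_comm, ← mul_assoc]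
  simp [Matrix.charpoly_diagonal]

open NumberField in
lemma one_le_prod_emb {K : Type*} [Field K] [NumberField K] (a : 𝓞 K) (ha : a ≠ 0) :
    1 ≤ ∏ σ : K →ₐ[ℚ] ℂ, ‖σ (a : K)‖ := by
  rw [← norm_prod, ← Algebra.norm_eq_prod_embeddings ℚ ℂ (a : K), ← Algebra.coe_norm_int]
  have : (1:ℤ) ≤ |Algebra.norm ℤ a| := Int.one_le_abs (Algebra.norm_ne_zero_iff.mpr ha)
  have h2 : (1:ℝ) ≤ |(Algebra.norm ℤ a : ℝ)| := by exact_mod_cast this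
  simpa using h2

open NumberField in
lemma num_bound {K : Type*} [Field K] [NumberField K] {n : Type*} [Fintype n] [DecidableEq n]
    (B : Matrix n n (𝓞 K)) (R : ℝ) (hR : 1 ≤ R)
    (hB : ∀ (σ : K →ₐ[ℚ] ℂ) (i : n), ∑ j, ‖σ (B i j : K)‖ ≤ R)
    (τ : K →ₐ[ℚ] ℂ) (μ : n → ℂ)
    (hμ : (B.map fun x => τ (x : K)).charpoly = ∏ i, (X - C (μ i)))
    (S : Finset n) (t : ℝ) (ht : 0 ≤ t) (hS : ∀ i ∈ S, μ i ≠ 0 ∧ ‖μ i‖ ≤ 2 * R * t) :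
    1 ≤ (2 * R) ^ (Fintype.card n * Fintype.card (K →ₐ[ℚ] ℂ)) * t ^ S.card := by
  classical
  let φ : (K →ₐ[ℚ] ℂ) → (𝓞 K →+* ℂ) := fun σ => (σ : K →+* ℂ).comp (algebraMap (𝓞 K) K)
  have hmap : ∀ σ, (B.map (φ σ)).charpoly = B.charpoly.map (φ σ) := fun σ =>
    Matrix.charpoly_map B (φ σ)
  let P := B.charpoly.map (φ τ)
  have hP : P = ∏ i, (X - C (μ i)) := by rw [← hμ]; exact (hmap τ).symm
  let k := P.natTrailingDegree
  let a := B.charpoly.coeff k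
  have hτa : τ (a : K) = P.trailingCoeff := by
    simp only [trailingCoeff, P, coeff_map]; rfl
  have hP0 : P ≠ 0 := ((Matrix.charpoly_monic B).map (φ τ)).ne_zero
  have ha : a ≠ 0 := by
    intro h
    rw [h] at hτa
    apply hP0
    rw [← Polynomial.trailingCoeff_eq_zero, ← hτa]; simp
  have hσ : ∀ σ : K →ₐ[ℚ] ℂ, ‖σ (a : K)‖ ≤ (2 * R) ^ Fintype.card n := by
    intro σ
    have := coeff_bound (B.map (φ σ)) R hR (hB σ) k
    rw [hmap, coeff_map] at this
    exact this
  have hroots : ∀ i, ‖μ i‖ ≤ R := by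
    intro i
    apply row_root (B.map fun x => τ (x : K)) R (hB τ)
    rw [hμ, mem_roots (Finset.prod_ne_zero_iff.mpr fun i _ => X_sub_C_ne_zero _), IsRoot, eval_prod]
    exact Finset.prod_eq_zero (Finset.mem_univ i) (by simp)
  have hτ : ‖τ (a : K)‖ ≤ (2 * R) ^ Fintype.card n * t ^ S.card := by
    rw [hτa, hP, trailing_prod]
    have : ∀ i, (if μ i = 0 then 1 else ‖μ i‖) ≤ 2 * R * (if i ∈ S then t else 1) := by
      intro i
      by_cases hi : i ∈ S
      · rw [if_neg (hS i hi).1, if_pos hi]; exact (hS i hi).2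
      · rw [if_neg hi]
        have := hroots i
        split_ifs <;> linarith
    refine (Finset.prod_le_prod (fun i _ => by split_ifs <;> simp) fun i _ => this i).trans ?_
    rw [Finset.prod_mul_distrib, Finset.prod_ite]
    simp
  have h1 := one_le_prod_emb a ha
  rw [← Finset.mul_prod_erase _ _ (Finset.mem_univ τ)] at h1
  refine h1.trans ?_
  have h2 : ∏ σ ∈ Finset.univ.erase τ, ‖σ (a : K)‖ ≤
      ∏ σ ∈ (Finset.univ : Finset (K →ₐ[ℚ] ℂ)).erase τ, (2 * R) ^ Fintype.card n :=
    Finset.prod_le_prod (fun _ _ => norm_nonneg _) fun σ _ => hσ σ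
  refine (mul_le_mul hτ h2 (Finset.prod_nonneg fun _ _ => norm_nonneg _) (by positivity)).trans
    (le_of_eq ?_)
  rw [mul_right_comm, Finset.mul_prod_erase _ (fun _ => (2 * R) ^ Fintype.card n)
    (Finset.mem_univ τ)]
  simp [← pow_mul]

end aux2

section aux3
open MonoidAlgebra Polynomial

def qm {G : Type*} [Group G] {d : ℕ} {R : Type*} [CommRing R] (X : Type*) [MulAction G X]
    [DecidableEq X] (S : Finset G) (a : G → Matrix (Fin d) (Fin d) R) :
    Matrix (X × Fin d) (X × Fin d) R :=
  Matrix.of fun p q => ∑ g ∈ S, if g⁻¹ • p.1 = q.1 then a g p.2 q.2 else 0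

lemma rho_eq_qm {G : Type*} [Group G] {d : ℕ} (X : Type*) [MulAction G X] [Fintype X]
    [DecidableEq X] (B : MonoidAlgebra (Matrix (Fin d) (Fin d) ℂ) G) :
    LinearMap.toMatrix' (rho X B) = qm X B.coeff.support B.coeff := by
  ext p q
  rw [LinearMap.toMatrix'_apply, rho_apply]
  simp only [qm, Matrix.of_apply]
  refine Finset.sum_congr rfl fun g _ => ?_
  obtain ⟨y, j⟩ := q
  simp only [Pi.single_apply, Prod.mk.injEq]
  by_cases h : g⁻¹ • p.1 = y <;> simp [h]

lemma qm_row {G : Type*} [Group G] {d : ℕ} (X : Type*) [MulAction G X] [Fintype X]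
    [DecidableEq X] (S : Finset G) (a : G → Matrix (Fin d) (Fin d) ℂ) (p : X × Fin d) :
    ∑ q, ‖qm X S a p q‖ ≤ ∑ g ∈ S, ∑ j, ‖a g p.2 j‖ := by
  calc ∑ q, ‖qm X S a p q‖ ≤
      ∑ q : X × Fin d, ∑ g ∈ S, if g⁻¹ • p.1 = q.1 then ‖a g p.2 q.2‖ else 0 := by
        refine Finset.sum_le_sum fun q _ => ?_
        simp only [qm, Matrix.of_apply]
        refine (norm_sum_le _ _).trans (le_of_eq ?_)
        refine Finset.sum_congr rfl fun g _ => ?_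
        split_ifs <;> simp
    _ = _ := by
        rw [Finset.sum_comm]
        refine Finset.sum_congr rfl fun g _ => ?_
        rw [Fintype.sum_prod_type, Finset.sum_comm]
        simp

lemma qm_herm {G : Type*} [Group G] {d : ℕ} (X : Type*) [MulAction G X] [Fintype X]
    [DecidableEq X] (B : MonoidAlgebra (Matrix (Fin d) (Fin d) ℂ) G) (hB : st B = B) :
    (qm X B.coeff.support B.coeff).IsHermitian := by
  have hs : ∀ g, B.coeff g⁻¹ = (B.coeff g).conjTranspose := by
    intro g; conv_lhs => rw [← hB]
    rw [st_coeff, inv_inv]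
  have hsupp : ∀ g ∈ B.coeff.support, g⁻¹ ∈ B.coeff.support := by
    intro g hg
    rw [Finsupp.mem_support_iff] at hg ⊢
    rw [hs]; simpa using hg
  ext p q
  rw [Matrix.conjTranspose_apply]
  simp only [qm, Matrix.of_apply, star_sum]
  refine Finset.sum_bij' (fun g _ => g⁻¹) (fun g _ => g⁻¹) hsupp hsupp (by simp) (by simp) ?_
  intro g _
  have : (g⁻¹ • q.1 = p.1) ↔ (g⁻¹⁻¹ • p.1 = q.1) := by
    rw [inv_inv, inv_smul_eq_iff, eq_comm]
  simp only [this, hs, Matrix.conjTranspose_apply]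
  split_ifs <;> simp

lemma exists_normal {G : Type*} [Group G]
    (hres : ∀ g : G, g ≠ 1 → ∃ N : Subgroup G, N.Normal ∧ N.index ≠ 0 ∧ g ∉ N) (S : Finset G) :
    ∃ N : Subgroup G, N.Normal ∧ N.index ≠ 0 ∧ ∀ g ∈ S, g ≠ 1 → g ∉ N := by
  classical
  induction S using Finset.induction_on with
  | empty => exact ⟨⊤, inferInstance, by simp, by simp⟩
  | insert a s ha ih =>
    obtain ⟨N, h1, h2, h3⟩ := ih
    by_cases ha1 : a = 1
    · refine ⟨N, h1, h2, ?_⟩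
      intro g hg hg1
      rcases Finset.mem_insert.mp hg with h | h
      · exact absurd (h.trans ha1) hg1
      · exact h3 g h hg1
    · obtain ⟨M, m1, m2, m3⟩ := hres a ha1
      refine ⟨N ⊓ M, inferInstance, Subgroup.index_inf_ne_zero h2 m2, ?_⟩
      intro g hg hg1 hm
      rcases Finset.mem_insert.mp hg with h | h
      · exact m3 (h ▸ hm.2)
      · exact h3 g h hg1 hm.1

lemma bump (lam R0 δ η : ℝ) (hR : 0 < R0) (hl : |lam| ≤ R0) (hδ : 0 < δ) (hη : 0 < η) :
    ∃ Q : Polynomial ℝ, Q.eval lam = 1 ∧ ∀ e : ℝ, |e| ≤ R0 →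
      Q.eval e ^ 2 ≤ (if |e - lam| < δ then 1 else 0) + η := by
  obtain ⟨M, hM⟩ : ∃ M : ℕ, (1 - min 1 ((δ / (2 * R0)) ^ 2)) ^ M < η := by
    apply exists_pow_lt_of_lt_one hη
    have : 0 < min 1 ((δ / (2 * R0)) ^ 2) := lt_min one_pos (by positivity)
    linarith
  have hb0 : 0 ≤ 1 - min 1 ((δ / (2 * R0)) ^ 2) := by
    have := min_le_left 1 ((δ / (2 * R0)) ^ 2); linarith
  have hb1 : 1 - min 1 ((δ / (2 * R0)) ^ 2) ≤ 1 := by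
    have : 0 < min 1 ((δ / (2 * R0)) ^ 2) := lt_min one_pos (by positivity)
    linarith
  refine ⟨(1 - (C (1 / (2 * R0)) * (X - C lam)) ^ 2) ^ M, by simp, ?_⟩
  intro e he
  simp only [eval_pow, eval_sub, eval_one, eval_mul, eval_C, eval_X]
  set u := 1 / (2 * R0) * (e - lam) with hu
  have hua : |u| = |e - lam| / (2 * R0) := by
    rw [hu, abs_mul, abs_of_pos (by positivity)]; ring
  have h1 : |u| ≤ 1 := by
    rw [hua, div_le_one (by positivity)]
    have := abs_sub e lam; linarith
  have h2 : u ^ 2 ≤ 1 := by rw [← sq_abs]; exact pow_le_one₀ (abs_nonneg _) h1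
  have h3 : 0 ≤ 1 - u ^ 2 := by linarith
  have h4 : (1 - u ^ 2) ^ M ≤ 1 := pow_le_one₀ h3 (by nlinarith [sq_nonneg u])
  have h5 : 0 ≤ (1 - u ^ 2) ^ M := pow_nonneg h3 _
  have h6 : ((1 - u ^ 2) ^ M) ^ 2 ≤ (1 - u ^ 2) ^ M := by nlinarith
  refine h6.trans ?_
  split_ifs with h
  · linarith
  · have : δ / (2 * R0) ≤ |u| := by
      rw [hua]; gcongr; linarith
    have h7 : (δ / (2 * R0)) ^ 2 ≤ u ^ 2 := by
      rw [← sq_abs u]; gcongr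
    have h8 := min_le_right 1 ((δ / (2 * R0)) ^ 2)
    have : (1 - u ^ 2) ^ M ≤ (1 - min 1 ((δ / (2 * R0)) ^ 2)) ^ M :=
      pow_le_pow_left₀ h3 (by linarith) _
    linarith

lemma count {G : Type*} [Group G] {d : ℕ} (hd : 1 ≤ d)
    (hres : ∀ g : G, g ≠ 1 → ∃ N : Subgroup G, N.Normal ∧ N.index ≠ 0 ∧ g ∉ N)
    (A : MonoidAlgebra (Matrix (Fin d) (Fin d) ℂ) G) (hA : st A = A)
    (lam c R0 δ : ℝ) (hc : 0 < c) (hR : 0 < R0) (hl : |lam| ≤ R0) (hδ : 0 < δ)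
    (hQ : ∀ Q : Polynomial ℝ, c * Q.eval lam ^ 2 ≤
      (∑ i, (aeval A (Q.map (algebraMap ℝ ℂ)) * aeval A (Q.map (algebraMap ℝ ℂ))).coeff 1 i i).re)
    (hrow : ∀ i, ∑ g ∈ A.coeff.support, ∑ j, ‖A.coeff g i j‖ ≤ R0) :
    ∃ N : Subgroup G, ∃ _ : N.Normal, ∃ _ : Fintype (G ⧸ N), ∃ _ : DecidableEq (G ⧸ N),
      c / 2 * Fintype.card (G ⧸ N) ≤
        ((Finset.univ.filter fun p : (G ⧸ N) × Fin d =>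
          |(qm_herm (G ⧸ N) A hA).eigenvalues p - lam| < δ).card : ℝ) := by
  classical
  have hd' : (0:ℝ) < d := by exact_mod_cast hd
  obtain ⟨Q, hQ1, hQ2⟩ := bump lam R0 δ (c / (2 * d)) hR hl hδ (by positivity)
  set Qc := Q.map (algebraMap ℝ ℂ) with hQc
  set B := aeval A Qc with hB
  obtain ⟨N, hN, hN2, hN3⟩ := exists_normal hres (B * B).coeff.support
  have : N.FiniteIndex := ⟨hN2⟩
  have : Finite (G ⧸ N) := Subgroup.finite_quotient_of_finiteIndex
  let I1 : Fintype (G ⧸ N) := Fintype.ofFinite _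
  refine ⟨N, hN, I1, inferInstance, ?_⟩
  set hM := qm_herm (G ⧸ N) A hA
  have h1 := trace_rho N (B * B) hN3
  have h2 : LinearMap.toMatrix' (rho (G ⧸ N) (B * B)) =
      aeval (qm (G ⧸ N) A.coeff.support A.coeff) (Qc * Qc) := by
    rw [← rho_eq_qm, hB, ← map_mul]
    have e1 := Polynomial.aeval_algHom_apply (rho (G ⧸ N)) A (Qc * Qc)
    have e2 := Polynomial.aeval_algHom_apply
      (LinearMap.toMatrixAlgEquiv' : _ ≃ₐ[ℂ] Matrix ((G ⧸ N) × Fin d) ((G ⧸ N) × Fin d) ℂ).toAlgHom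
      (rho (G ⧸ N) A) (Qc * Qc)
    rw [← e1]
    exact e2.symm
  rw [h2, herm_trace _ hM] at h1
  have h3 : ∀ p, ((Qc * Qc).eval (hM.eigenvalues p : ℂ)) = ((Q.eval (hM.eigenvalues p) ^ 2 : ℝ) : ℂ) := by
    intro p
    rw [eval_mul, hQc]
    have : eval (hM.eigenvalues p : ℂ) (Q.map (algebraMap ℝ ℂ)) = ((Q.eval (hM.eigenvalues p) : ℝ) : ℂ) := by
      rw [Polynomial.eval_map]
      exact Polynomial.eval₂_at_apply (algebraMap ℝ ℂ) _
    rw [this]; push_cast; ring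
  rw [Finset.sum_congr rfl fun p _ => h3 p, ← Complex.ofReal_sum] at h1
  have h4 : ∑ p, Q.eval (hM.eigenvalues p) ^ 2 =
      (Fintype.card (G ⧸ N) : ℝ) * (∑ i, (B * B).coeff 1 i i).re := by
    have := congrArg Complex.re h1
    rw [Complex.ofReal_re, ← Complex.ofReal_natCast, Complex.re_ofReal_mul] at this
    exact this
  have h5 : c ≤ (∑ i, (B * B).coeff 1 i i).re := by
    have := hQ Q
    rw [hQ1, one_pow, mul_one] at this; exact this
  have hev : ∀ p, |hM.eigenvalues p| ≤ R0 := by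
    intro p
    have := row_root (qm (G ⧸ N) A.coeff.support A.coeff) R0
      (fun q => (qm_row (G ⧸ N) A.coeff.support A.coeff q).trans (hrow q.2)) (hM.eigenvalues p : ℂ)
      (by rw [hM.roots_charpoly_eq_eigenvalues]; simp)
    simpa using this
  have h6 : ∑ p, Q.eval (hM.eigenvalues p) ^ 2 ≤
      ∑ p, ((if |hM.eigenvalues p - lam| < δ then (1:ℝ) else 0) + c / (2 * d)) :=
    Finset.sum_le_sum fun p _ => hQ2 _ (hev p)
  rw [Finset.sum_add_distrib, Finset.sum_boole, Finset.sum_const, Finset.card_univ,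
    Fintype.card_prod, Fintype.card_fin, nsmul_eq_mul, h4] at h6
  have h7 : (((Fintype.card (G ⧸ N) * d : ℕ) : ℝ)) * (c / (2 * d)) =
      c / 2 * Fintype.card (G ⧸ N) := by
    push_cast; field_simp
  rw [h7] at h6
  have h8 : (Fintype.card (G ⧸ N) : ℝ) * c ≤
      (Fintype.card (G ⧸ N) : ℝ) * (∑ i, (B * B).coeff 1 i i).re := by gcongr
  linarith

end aux3

section aux4
open MonoidAlgebra Polynomial NumberField

lemma exists_lift {G : Type*} [Group G] {d : ℕ}
    (A : G →₀ Matrix (Fin d) (Fin d) ℂ)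
    (halg : ∀ (g : G) (i j : Fin d), IsAlgebraic ℚ (A g i j)) :
    ∃ (K : IntermediateField ℚ ℂ) (_ : NumberField K) (D : ℤ)
      (β : G → Matrix (Fin d) (Fin d) (𝓞 K)), D ≠ 0 ∧
      ∀ g ∈ A.support, ∀ i j, (((β g i j : 𝓞 K) : K) : ℂ) = D * A g i j := by
  classical
  let E : Finset ℂ := A.support.biUnion fun g =>
    (Finset.univ : Finset (Fin d × Fin d)).image fun p => A g p.1 p.2
  let K : IntermediateField ℚ ℂ := IntermediateField.adjoin ℚ (E : Set ℂ)
  have hE : ∀ x ∈ (E : Set ℂ), IsIntegral ℚ x := by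
    intro x hx
    simp only [E, Finset.coe_biUnion, Set.mem_iUnion, Finset.coe_image, Set.mem_image] at hx
    obtain ⟨g, _, p, _, rfl⟩ := hx
    exact (halg g p.1 p.2).isIntegral
  have hfd : FiniteDimensional ℚ K :=
    IntermediateField.finiteDimensional_adjoin hE
  have hK : NumberField K := { to_charZero := inferInstance, to_finiteDimensional := hfd }
  have hmem : ∀ g ∈ A.support, ∀ i j, A g i j ∈ K := by
    intro g hg i j
    apply IntermediateField.subset_adjoin
    simp only [E, Finset.coe_biUnion, Set.mem_iUnion, Finset.coe_image, Set.mem_image]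
    exact ⟨g, hg, (i, j), by simp, rfl⟩
  let α : G → Fin d → Fin d → K := fun g i j =>
    if h : A g i j ∈ K then ⟨A g i j, h⟩ else 0
  obtain ⟨D, hD, hint⟩ := exists_integral_multiples ℤ ℚ (L := K)
    (A.support.biUnion fun g =>
      (Finset.univ : Finset (Fin d × Fin d)).image fun p => α g p.1 p.2)
  have hlift : ∀ z : K, ∃ y : 𝓞 K, IsIntegral ℤ z → (y : K) = z := by
    intro z
    by_cases h : IsIntegral ℤ z
    · exact ⟨⟨z, h⟩, fun _ => rfl⟩
    · exact ⟨0, fun h' => absurd h' h⟩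
  choose b hb using hlift
  refine ⟨K, hK, D, fun g => Matrix.of fun i j => b (D • α g i j), hD, ?_⟩
  intro g hg i j
  have h1 : IsIntegral ℤ (D • α g i j) := by
    apply hint
    rw [Finset.mem_biUnion]
    exact ⟨g, hg, Finset.mem_image.mpr ⟨(i, j), by simp, rfl⟩⟩
  change ((b (D • α g i j) : K) : ℂ) = _
  rw [hb _ h1]
  simp only [α]
  rw [dif_pos (hmem g hg i j)]
  simp

lemma core {G : Type*} [Group G]
    (hres : ∀ g : G, g ≠ 1 → ∃ N : Subgroup G, N.Normal ∧ N.index ≠ 0 ∧ g ∉ N)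
    (d : ℕ) (hd : 1 ≤ d)
    (A : MonoidAlgebra (Matrix (Fin d) (Fin d) ℂ) G)
    (halg : ∀ (g : G) (i j : Fin d), IsAlgebraic ℚ (A.coeff g i j))
    (hA : st A = A) (lam : ℝ)
    (hliouville : ∀ n : ℕ, ∃ p q : ℤ, 2 ≤ q ∧
      0 < |lam - (p : ℝ) / q| ∧ |lam - (p : ℝ) / q| ≤ ((q : ℝ) ^ n)⁻¹)
    (c : ℝ) (hc : 0 < c)
    (hQ : ∀ Q : Polynomial ℝ, c * Q.eval lam ^ 2 ≤
      (∑ i, (aeval A (Q.map (algebraMap ℝ ℂ)) * aeval A (Q.map (algebraMap ℝ ℂ))).coeff 1 i i).re) :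
    False := by
  classical
  obtain ⟨K, hK, D, β, hD, hβ⟩ := exists_lift A.coeff halg
  have hD1 : (1:ℝ) ≤ |(D:ℝ)| := by exact_mod_cast Int.one_le_abs hD
  set S := A.coeff.support with hSdef
  -- bounds
  set R1 : ℝ := ∑ σ : K →ₐ[ℚ] ℂ, ∑ i, ∑ g ∈ S, ∑ j, ‖σ (β g i j : K)‖ with hR1
  have hR1n : 0 ≤ R1 := by positivity
  have hσb : ∀ (σ : K →ₐ[ℚ] ℂ) (i : Fin d), ∑ g ∈ S, ∑ j, ‖σ (β g i j : K)‖ ≤ R1 := by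
    intro σ i
    refine le_trans ?_ (Finset.single_le_sum (f := fun σ : K →ₐ[ℚ] ℂ =>
      ∑ i, ∑ g ∈ S, ∑ j, ‖σ (β g i j : K)‖) (fun _ _ => by positivity) (Finset.mem_univ σ))
    exact Finset.single_le_sum (f := fun i => ∑ g ∈ S, ∑ j, ‖σ (β g i j : K)‖)
      (fun _ _ => by positivity) (Finset.mem_univ i)
  set τ : K →ₐ[ℚ] ℂ := K.val with hτ
  set R0 : ℝ := 1 + |lam| + R1 with hR0
  have hR0p : 0 < R0 := by positivity
  have hrow : ∀ i, ∑ g ∈ A.coeff.support, ∑ j, ‖A.coeff g i j‖ ≤ R0 := by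
    intro i
    have h1 : ∑ g ∈ A.coeff.support, ∑ j, ‖A.coeff g i j‖ ≤ ∑ g ∈ S, ∑ j, ‖τ (β g i j : K)‖ := by
      refine Finset.sum_le_sum fun g hg => Finset.sum_le_sum fun j _ => ?_
      have : τ (β g i j : K) = D * A.coeff g i j := hβ g hg i j
      rw [this, norm_mul, Complex.norm_intCast]
      exact le_mul_of_one_le_left (norm_nonneg _) hD1
    have := hσb τ i
    have := abs_nonneg lam
    linarith
  set r := Fintype.card (K →ₐ[ℚ] ℂ) with hr
  set C0 : ℝ := R1 + |(D:ℝ)| * (|lam| + 1) with hC0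
  have hC01 : 1 ≤ C0 := by
    have : 1 * 1 ≤ |(D:ℝ)| * (|lam| + 1) :=
      mul_le_mul hD1 (by linarith [abs_nonneg lam]) (by norm_num) (by positivity)
    linarith
  obtain ⟨s, hs⟩ : ∃ s : ℕ, 2 * C0 < 2 ^ s := pow_unbounded_of_one_lt _ (by norm_num)
  obtain ⟨n, hn⟩ := exists_nat_gt (((s + 1) * d * r : ℝ) / (c / 2))
  rw [div_lt_iff₀ (by positivity)] at hn
  obtain ⟨p, q, hq, hpos, hle⟩ := hliouville n
  have hq2 : (2:ℝ) ≤ q := by exact_mod_cast hq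
  have hq0 : (0:ℝ) < q := by linarith
  obtain ⟨N, hN, I1, I2, hcount⟩ := count hd hres A hA lam c R0 |lam - (p : ℝ) / q| hc hR0p
    (by rw [hR0]; linarith) hpos hQ hrow
  set hM := qm_herm (G ⧸ N) A hA with hMdef
  set Sn := (Finset.univ.filter fun x : (G ⧸ N) × Fin d =>
          |hM.eigenvalues x - lam| < |lam - (p : ℝ) / q|) with hSn
  -- integer matrix
  let B : Matrix ((G ⧸ N) × Fin d) ((G ⧸ N) × Fin d) (𝓞 K) :=
    (q : 𝓞 K) • qm (G ⧸ N) S β - ((D * p : ℤ) : 𝓞 K) • 1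
  have hBσ : ∀ (σ : K →ₐ[ℚ] ℂ) x y, σ (B x y : K) =
      q * qm (G ⧸ N) S (fun g => (β g).map fun z => σ (z : K)) x y -
        (D * p) * (1 : Matrix ((G ⧸ N) × Fin d) ((G ⧸ N) × Fin d) ℂ) x y := by
    intro σ x y
    let φ : 𝓞 K →+* ℂ := (σ : K →+* ℂ).comp (algebraMap (𝓞 K) K)
    change φ (B x y) = _
    simp only [B, qm, Matrix.sub_apply, Matrix.smul_apply, Matrix.of_apply, smul_eq_mul,
      Matrix.one_apply, map_sub, map_mul, map_sum, map_intCast]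
    congr 1
    · congr 1
      refine Finset.sum_congr rfl fun g _ => ?_
      split_ifs
      · rfl
      · simp
    · push_cast
      congr 1
      split_ifs <;> simp
  have hpb : |(p:ℝ)| ≤ q * (|lam| + 1) := by
    have h1 : |lam - (p:ℝ) / q| ≤ 1 :=
      hle.trans (inv_le_one_of_one_le₀ (one_le_pow₀ (by linarith)))
    have h2 : |(p:ℝ) / q| ≤ |lam| + 1 := by
      have := abs_sub_abs_le_abs_sub ((p:ℝ) / q) lam
      rw [abs_sub_comm] at this
      linarith
    rw [abs_div, abs_of_pos hq0, div_le_iff₀ hq0] at h2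
    linarith
  have hBrow : ∀ (σ : K →ₐ[ℚ] ℂ) x, ∑ y, ‖σ (B x y : K)‖ ≤ q * C0 := by
    intro σ x
    have h1 : ∀ y, ‖σ (B x y : K)‖ ≤
        q * ‖qm (G ⧸ N) S (fun g => (β g).map fun z => σ (z : K)) x y‖ +
          |(D:ℝ)| * |(p:ℝ)| * (if x = y then 1 else 0) := by
      intro y
      rw [hBσ]
      refine (norm_sub_le _ _).trans (le_of_eq ?_)
      rw [norm_mul, norm_mul, norm_mul, Complex.norm_intCast, Complex.norm_intCast,
        Complex.norm_intCast, abs_of_pos hq0, Matrix.one_apply]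
      congr 2
      split_ifs <;> simp
    refine (Finset.sum_le_sum fun y _ => h1 y).trans ?_
    rw [Finset.sum_add_distrib, ← Finset.mul_sum, ← Finset.mul_sum, Finset.sum_ite_eq]
    simp only [Finset.mem_univ, if_true, mul_one]
    have h2 := (qm_row (G ⧸ N) S (fun g => (β g).map fun z => σ (z : K)) x).trans (hσb σ x.2)
    have h3 : (q:ℝ) * ∑ y, ‖qm (G ⧸ N) S (fun g => (β g).map fun z => σ (z : K)) x y‖ ≤ q * R1 := by
      gcongr
    have h4 : |(D:ℝ)| * |(p:ℝ)| ≤ |(D:ℝ)| * (q * (|lam| + 1)) := by gcongr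
    rw [hC0]
    linarith
  let Qp : Polynomial ℂ := C ((D:ℂ) * q) * X - C ((D:ℂ) * p)
  have hBτ : (B.map fun x => τ (x : K)) = aeval (qm (G ⧸ N) A.coeff.support A.coeff) Qp := by
    ext x y
    rw [Matrix.map_apply, hBσ]
    simp only [Qp, map_sub, map_mul, aeval_C, aeval_X]
    rw [← map_mul, ← map_mul, ← Algebra.smul_def, Algebra.algebraMap_eq_smul_one, Matrix.sub_apply, Matrix.smul_apply, Matrix.smul_apply]
    simp only [smul_eq_mul]
    congr 1
    rw [mul_comm (D:ℂ) (q:ℂ), mul_assoc]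
    congr 1
    simp only [qm, Matrix.of_apply, Finset.mul_sum]
    refine Finset.sum_congr rfl fun g hg => ?_
    split_ifs
    · exact hβ g hg _ _
    · simp
  have hnum := num_bound B (q * C0) (by nlinarith) hBrow τ
    (fun x => Qp.eval (hM.eigenvalues x : ℂ))
    (by rw [hBτ]; exact herm_charpoly _ hM Qp) Sn ((q:ℝ) ^ n)⁻¹ (by positivity) (by
      intro x hx
      rw [hSn, Finset.mem_filter] at hx
      have hx := hx.2
      have e1 : Qp.eval (hM.eigenvalues x : ℂ) =
          (((D:ℝ) * q * (hM.eigenvalues x - (p:ℝ) / q) : ℝ) : ℂ) := by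
        have : (q:ℂ) ≠ 0 := by exact_mod_cast hq0.ne'
        simp only [Qp, eval_sub, eval_mul, eval_C, eval_X]
        push_cast
        field_simp
      have hDR : (D:ℝ) ≠ 0 := by exact_mod_cast hD
      rw [e1]
      constructor
      · rw [Ne, Complex.ofReal_eq_zero]
        refine mul_ne_zero (mul_ne_zero hDR hq0.ne') ?_
        intro h
        have : hM.eigenvalues x = (p:ℝ) / q := by linarith
        rw [this, abs_sub_comm] at hx
        exact lt_irrefl _ hx
      · rw [Complex.norm_real, Real.norm_eq_abs, abs_mul, abs_mul, abs_of_pos hq0]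
        have e2 : |hM.eigenvalues x - (p:ℝ) / q| ≤ 2 * ((q:ℝ) ^ n)⁻¹ := by
          have := abs_sub_le (hM.eigenvalues x) lam ((p:ℝ) / q)
          linarith
        have e3 : |(D:ℝ)| ≤ C0 := by
          have : |(D:ℝ)| * 1 ≤ |(D:ℝ)| * (|lam| + 1) := by
            gcongr; linarith [abs_nonneg lam]
          linarith
        calc |(D:ℝ)| * q * |hM.eigenvalues x - (p:ℝ) / q| ≤ C0 * q * (2 * ((q:ℝ) ^ n)⁻¹) := by
              gcongr
          _ = _ := by ring)
  rw [Fintype.card_prod, Fintype.card_fin, ← hr, inv_pow, ← pow_mul] at hnum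
  set m := Fintype.card (G ⧸ N) with hm
  have hm0 : 0 < m := Fintype.card_pos
  have hb : 2 * (q * C0) ≤ (q:ℝ) ^ (s + 1) := by
    have : 2 * C0 ≤ (q:ℝ) ^ s := hs.le.trans (pow_le_pow_left₀ (by norm_num) hq2 s)
    rw [pow_succ]
    nlinarith
  have h9 : (q:ℝ) ^ (n * Sn.card) ≤ (q:ℝ) ^ ((s + 1) * (m * d * r)) := by
    rw [← div_eq_mul_inv, le_div_iff₀ (by positivity), one_mul] at hnum
    refine hnum.trans ?_
    rw [pow_mul _ (s + 1)]
    exact pow_le_pow_left₀ (by positivity) hb _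
  have h10 : n * Sn.card ≤ (s + 1) * (m * d * r) :=
    (pow_le_pow_iff_right₀ (by linarith)).mp h9
  have h11 : (n:ℝ) * Sn.card ≤ (s + 1) * (m * d * r) := by exact_mod_cast h10
  have h12 : (n:ℝ) * (c / 2 * m) ≤ (n:ℝ) * Sn.card := by gcongr
  have hmR : (0:ℝ) < m := by exact_mod_cast hm0
  have h13 : ((s + 1) * d * r : ℝ) * m < n * (c / 2) * m := by gcongr
  nlinarith

end aux4

/-- Let `G` be a residually finite group and `A = A* ∈ M_d(ℚ̄G)` a
self-adjoint matrix over the algebraic group ring.  If `λ ∈ ℝ` is a Liouville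
transcendental number (for every `n` there are integers `p, q` with `q ≥ 2` and
`0 < |λ − p/q| ≤ q^{−n}`), then `λ` is not an eigenvalue of `A` on `ℓ²(G; ℂ^d)`. -/
theorem liouville_not_eigenvalue_of_residually_finite
    (G : Type*) [Group G]
    (hres : ∀ g : G, g ≠ 1 → ∃ N : Subgroup G, N.Normal ∧ N.index ≠ 0 ∧ g ∉ N)
    (d : ℕ) (hd : 1 ≤ d)
    (A : G →₀ Matrix (Fin d) (Fin d) ℂ)
    (halg : ∀ (g : G) (i j : Fin d), IsAlgebraic ℚ (A g i j))
    (hsa : ∀ g : G, A g = (A g⁻¹).conjTranspose)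
    (T : L2 G d →L[ℂ] L2 G d) (hT : Represents A T)
    (lam : ℝ)
    (hliouville : ∀ n : ℕ, ∃ p q : ℤ, 2 ≤ q ∧
      0 < |lam - (p : ℝ) / q| ∧ |lam - (p : ℝ) / q| ≤ ((q : ℝ) ^ n)⁻¹) :
    ∀ f : L2 G d, T f = (lam : ℂ) • f → f = 0 := by
  intro f hf
  by_contra hf0
  obtain ⟨⟨x0, i0⟩, hx0⟩ : ∃ p, f p ≠ 0 := by
    by_contra h
    push Not at h
    exact hf0 (lp.ext (funext h))
  let A' : MonoidAlgebra (Matrix (Fin d) (Fin d) ℂ) G := MonoidAlgebra.ofCoeff A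
  have hA : st A' = A' := by
    apply MonoidAlgebra.coeff_injective
    ext1 g
    rw [st_coeff]
    exact (hsa g).symm
  let f' : G × Fin d → ℂ := fun p => f (p.1 * x0, p.2)
  have heig : rho G A' f' = (lam : ℂ) • f' := by
    ext ⟨y, i⟩
    rw [rho_apply]
    have h1 := hT f (y * x0) i
    rw [hf] at h1
    refine Eq.trans ?_ h1.symm
    refine Finset.sum_congr rfl fun g _ => Finset.sum_congr rfl fun j _ => ?_
    simp [A', f', mul_assoc]
  have hF : ∀ s : Finset (G × Fin d), ∑ p ∈ s, ‖f' p‖ ^ 2 ≤ ‖f‖ ^ 2 := by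
    intro s
    let em : G × Fin d ↪ G × Fin d := 
      ⟨fun p => (p.1 * x0, p.2), by
        rintro ⟨a, b⟩ ⟨a', b'⟩ h
        simpa using h⟩
    have h1 := lp.sum_rpow_le_norm_rpow (p := 2) (by norm_num) f (s.map em)
    rw [Finset.sum_map] at h1
    simp only [ENNReal.toReal_ofNat, Real.rpow_ofNat] at h1
    exact h1
  have hFpos : 0 < ‖f‖ ^ 2 := by
    have : 0 < ‖f‖ := norm_pos_iff.mpr hf0
    positivity
  have hf1 : 0 < ‖f' (1, i0)‖ := by
    rw [norm_pos_iff]; simpa [f'] using hx0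
  refine core hres d hd A' halg hA lam hliouville (‖f' (1, i0)‖ ^ 2 / ‖f‖ ^ 2) (by positivity) ?_
  intro Q
  set B := Polynomial.aeval A' (Q.map (algebraMap ℝ ℂ)) with hB
  have hBs : st B = B := st_aeval A' hA Q
  have hBf : rho G B f' = ((Q.eval lam : ℝ) : ℂ) • f' := by
    rw [hB, ← Polynomial.aeval_algHom_apply]
    have hev : Module.End.HasEigenvector (rho G A') (lam : ℂ) f' := by
      refine ⟨Module.End.mem_eigenspace_iff.mpr heig, ?_⟩
      intro h
      rw [h] at hf1
      simp at hf1
    rw [Module.End.aeval_apply_of_hasEigenvector hev, Polynomial.eval_map]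
    congr 1
    exact Polynomial.eval₂_at_apply (algebraMap ℝ ℂ) _
  have hlb := fun i => lower_bound B hBs f' (‖f‖ ^ 2) hF _ hBf i
  have h0 : ∀ i, 0 ≤ ((B * B).coeff 1 i i).re := by
    intro i
    have h1 := hlb i
    have h2 : 0 ≤ ‖f‖ ^ 2 * ((B * B).coeff 1 i i).re := le_trans (by positivity) h1
    exact nonneg_of_mul_nonneg_right h2 hFpos
  rw [Complex.re_sum]
  refine le_trans ?_ (Finset.single_le_sum (fun i _ => h0 i) (Finset.mem_univ i0))
  have h1 := hlb i0
  rw [Complex.norm_real, Real.norm_eq_abs, sq_abs] at h1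
  rw [div_mul_eq_mul_div, div_le_iff₀ hFpos]
  linarith

end
end

section
/- Let G be a finitely generated amenable group with finite symmetric generating set S and a Følner exhaustion: finite subsets X₁ ⊆ X₂ ⊆ ⋯ ⊆ G with ⋃_i X_i = G and |S·X_i \ X_i| / |X_i| → 0 as i → ∞. Let B ∈ M_d(ℂG) act on ℓ²(G;ℂ^d) by convolution, set A := B*B, and for each i set B[i] := P_i B P_i* and A[i] := B[i]* B[i], where P_i : ℓ²(G;ℂ^d) → ℓ²(X_i;ℂ^d) is the orthogonal (coordinate) projection, so that A[i] is a positive self-adjoint operator on the finite-dimensional space ℓ²(X_i;ℂ^d). Then the spectrum of A is contained in the closure of ⋃_{i=1}^∞ spec(A[i]), and moreover every eigenvalue of A (i.e. every λ with Af = λf for some nonzero f ∈ ℓ²(G;ℂ^d)) lies in ⋃_{i=1}^∞ spec(A[i]). -/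
set_option synthInstance.maxHeartbeats 1000000
set_option maxHeartbeats 1000000

noncomputable section

open scoped Classical Pointwise

/-- The compression `B[i] = P_i B P_i*` of a matrix `B ∈ M_d(ℂG)` to the finite subset
`Y ⊆ G`, as a finite matrix indexed by `Y × Fin d`: its entry at `((x,i),(y,j))` is
`(B_{x y⁻¹})_{ij}`. -/
noncomputable def cutMatrix {G : Type*} [Group G] {d : ℕ}
    (B : G →₀ Matrix (Fin d) (Fin d) ℂ) (Y : Finset G) :
    Matrix (↥Y × Fin d) (↥Y × Fin d) ℂ :=
  fun p q => B ((p.1 : G) * (q.1 : G)⁻¹) p.2 q.2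

/-- The finite-dimensional positive self-adjoint operator `A[i] = B[i]* B[i]`. -/
noncomputable def cutA {G : Type*} [Group G] {d : ℕ}
    (B : G →₀ Matrix (Fin d) (Fin d) ℂ) (Y : Finset G) :
    Matrix (↥Y × Fin d) (↥Y × Fin d) ℂ :=
  (cutMatrix B Y).conjTranspose * cutMatrix B Y

section helpers

open scoped InnerProductSpace

lemma adj_apply {G : Type*} [Group G] {d : ℕ} (B : G →₀ Matrix (Fin d) (Fin d) ℂ)
    (T : L2 G d →L[ℂ] L2 G d) (hT : Represents B T) (h : L2 G d) (y : G) (j : Fin d) :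
    ContinuousLinearMap.adjoint T h (y, j) =
      ∑ g ∈ B.support, ∑ i : Fin d, star (B g i j) * h (g * y, i) := by
  have key : T (lp.single 2 ((y, j) : G × Fin d) (1 : ℂ)) =
      ∑ g ∈ B.support, ∑ i : Fin d, lp.single 2 ((g * y, i) : G × Fin d) (B g i j) := by
    ext ⟨x, i⟩
    rw [hT, lp.coeFn_sum, Finset.sum_apply]
    refine Finset.sum_congr rfl fun g _ => ?_
    rw [lp.coeFn_sum, Finset.sum_apply]
    by_cases hx : x = g * y
    · subst hx
      rw [Finset.sum_eq_single j, Finset.sum_eq_single i]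
      · simp [lp.single_apply]
      · intro b _ hb
        rw [lp.single_apply_ne]
        intro h'; exact hb (Prod.ext_iff.1 h').2.symm
      · simp
      · intro b _ hb
        rw [lp.single_apply_ne, mul_zero]
        intro h'; exact hb (Prod.ext_iff.1 h').2
      · simp
    · rw [Finset.sum_eq_zero, Finset.sum_eq_zero]
      · intro b _
        rw [lp.single_apply_ne]
        intro h'; exact hx (Prod.ext_iff.1 h').1
      · intro b _
        rw [lp.single_apply_ne, mul_zero]
        intro h'; apply hx
        have := (Prod.ext_iff.1 h').1
        simp only at this
        rw [← this]; group
  have h1 : ContinuousLinearMap.adjoint T h (y, j) =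
      ⟪lp.single 2 ((y, j) : G × Fin d) (1 : ℂ), ContinuousLinearMap.adjoint T h⟫_ℂ := by
    rw [lp.inner_single_left]; simp
  rw [h1, ContinuousLinearMap.adjoint_inner_right, key, sum_inner]
  refine Finset.sum_congr rfl fun g _ => ?_
  rw [sum_inner]
  refine Finset.sum_congr rfl fun i _ => ?_
  rw [lp.inner_single_left]
  simp [mul_comm]

/-- The collar. -/
def collar {G : Type*} [Group G] (K X : Finset G) : Finset G :=
  (K⁻¹ * ((K * X) \ X)) ∪ ((K⁻¹ * X) \ X)

lemma sum_cut {G : Type*} [Group G] (K X : Finset G) (F : G → ℂ) (φ : G → G)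
    (hφ : Function.Injective φ) (hK : ∀ g, g ∉ K → F g = 0)
    (hX : ∀ g ∈ K, φ g ∉ X → F g = 0) (ψ : G → G) (hψ : ∀ x, φ (ψ x) = x) :
    ∑ y : ↥X, F (ψ y) = ∑ g ∈ K, F g := by
  rw [Finset.sum_coe_sort X (fun y => F (ψ y))]
  have hψ' : ∀ g, ψ (φ g) = g := fun g => hφ (hψ _)
  have h1 : ∑ g ∈ K, F g = ∑ g ∈ K.filter (fun g => φ g ∈ X), F g := by
    rw [Finset.sum_filter]
    refine Finset.sum_congr rfl fun g hg => ?_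
    split_ifs with h
    · rfl
    · exact hX g hg h
  have h2 : ∑ y ∈ X, F (ψ y) = ∑ y ∈ X.filter (fun y => ψ y ∈ K), F (ψ y) := by
    rw [Finset.sum_filter]
    refine Finset.sum_congr rfl fun g hg => ?_
    split_ifs with h
    · rfl
    · exact hK _ h
  rw [h1, h2]
  refine Finset.sum_bij' (fun y _ => ψ y) (fun g _ => φ g) ?_ ?_ ?_ ?_ ?_
  · intro a ha; simp only [Finset.mem_filter] at ha ⊢; rw [hψ]; exact ⟨ha.2, ha.1⟩
  · intro a ha; simp only [Finset.mem_filter] at ha ⊢; rw [hψ']; exact ⟨ha.2, ha.1⟩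
  · intro a _; exact hψ a
  · intro a _; exact hψ' a
  · intro a _; rfl

lemma cutA_mulVec {G : Type*} [Group G] {d : ℕ} (B : G →₀ Matrix (Fin d) (Fin d) ℂ)
    (T : L2 G d →L[ℂ] L2 G d) (hT : Represents B T) (X : Finset G) (v : L2 G d)
    (hv : ∀ z ∈ collar B.support X, ∀ j, v (z, j) = 0) :
    (cutA B X).mulVec (fun p : ↥X × Fin d => v ((p.1 : G), p.2)) =
      fun p : ↥X × Fin d => (ContinuousLinearMap.adjoint T ∘L T) v ((p.1 : G), p.2) := by
  have h1 : (cutMatrix B X).mulVec (fun p : ↥X × Fin d => v ((p.1 : G), p.2)) =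
      fun p : ↥X × Fin d => T v ((p.1 : G), p.2) := by
    funext ⟨x, i⟩
    simp only [Matrix.mulVec, dotProduct, cutMatrix]
    rw [hT, Fintype.sum_prod_type]
    have := sum_cut B.support X (fun g => ∑ j, B g i j * v (g⁻¹ * x, j)) (fun g => g⁻¹ * x)
      (fun a b h => by simpa using h)
      (fun g hg => by
        rw [Finsupp.notMem_support_iff] at hg; simp [hg])
      (fun g hg hx => by
        refine Finset.sum_eq_zero fun j _ => ?_
        rw [hv, mul_zero]
        refine Finset.mem_union_right _ (Finset.mem_sdiff.2 ⟨?_, hx⟩)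
        exact Finset.mul_mem_mul (Finset.inv_mem_inv hg) x.2)
      (fun y => (x : G) * y⁻¹) (fun y => by group)
    rw [← this]
    refine Finset.sum_congr rfl fun y _ => Finset.sum_congr rfl fun j _ => ?_
    simp
  rw [cutA, ← Matrix.mulVec_mulVec, h1]
  funext ⟨y, j⟩
  simp only [Matrix.mulVec, dotProduct, cutMatrix, Matrix.conjTranspose_apply,
    ContinuousLinearMap.comp_apply]
  rw [adj_apply B T hT, Fintype.sum_prod_type]
  have := sum_cut B.support X (fun g => ∑ i, star (B g i j) * T v (g * y, i)) (fun g => g * y)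
      (fun a b h => by simpa using h)
      (fun g hg => by
        rw [Finsupp.notMem_support_iff] at hg; simp [hg])
      (fun g hg hx => by
        refine Finset.sum_eq_zero fun i _ => ?_
        rw [hT, Finset.sum_eq_zero, mul_zero]
        intro g' hg'
        refine Finset.sum_eq_zero fun k _ => ?_
        rw [hv, mul_zero]
        refine Finset.mem_union_left _ ?_
        refine Finset.mul_mem_mul (Finset.inv_mem_inv hg') (Finset.mem_sdiff.2 ⟨?_, hx⟩)
        exact Finset.mul_mem_mul hg y.2)
      (fun x => x * (y : G)⁻¹) (fun y => by group)
  rw [← this]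
  refine Finset.sum_congr rfl fun x _ => Finset.sum_congr rfl fun i _ => ?_
  simp

lemma hermitian_bound {n : Type*} [Fintype n] [DecidableEq n] (M : Matrix n n ℂ) (hM : M.IsHermitian)
    (lam : ℂ) (ε : ℝ) (hε : 0 ≤ ε) (h : ∀ μ ∈ spectrum ℂ M, ε ≤ ‖μ - lam‖) (u : n → ℂ) :
    ε ^ 2 * ∑ p, ‖u p‖ ^ 2 ≤ ∑ p, ‖(M.mulVec u) p - lam * u p‖ ^ 2 := by
  set b := hM.eigenvectorBasis
  set U : EuclideanSpace ℂ n := WithLp.toLp 2 u with hU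
  set W : EuclideanSpace ℂ n := WithLp.toLp 2 (M.mulVec u - lam • u) with hW
  have e1 : ∑ p, ‖u p‖ ^ 2 = ‖U‖ ^ 2 := by rw [EuclideanSpace.norm_sq_eq]
  have e2 : ∑ p, ‖(M.mulVec u) p - lam * u p‖ ^ 2 = ‖W‖ ^ 2 := by
    rw [EuclideanSpace.norm_sq_eq]; simp [hW]
  rw [e1, e2, ← b.sum_sq_norm_inner_right U, ← b.sum_sq_norm_inner_right W, Finset.mul_sum]
  refine Finset.sum_le_sum fun k _ => ?_
  have hk : ⟪b k, W⟫_ℂ = ((hM.eigenvalues k : ℂ) - lam) * ⟪b k, U⟫_ℂ := by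
    have hs := (Matrix.isSymmetric_toEuclideanLin_iff.2 hM) (b k) U
    have h3 : Matrix.toEuclideanLin M (b k) = (hM.eigenvalues k : ℂ) • b k := by
      have := hM.mulVec_eigenvectorBasis k
      ext p
      have := congrFun this p
      simpa [Matrix.toLpLin_apply] using this
    have h4 : W = Matrix.toEuclideanLin M U - lam • U := by
      ext p; simp [hW, hU, Matrix.toLpLin_apply]
    rw [h4, inner_sub_right, ← hs, h3, inner_smul_left, inner_smul_right]
    simp; ring
  rw [hk, norm_mul, mul_pow]
  have hmem : (hM.eigenvalues k : ℂ) ∈ spectrum ℂ M := by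
    rw [hM.spectrum_eq_image_range]
    exact ⟨_, ⟨k, rfl⟩, rfl⟩
  gcongr
  exact h _ hmem

lemma l2_sum_le {G : Type*} {d : ℕ} (v : L2 G d) (X : Finset G) :
    ∑ p : ↥X × Fin d, ‖v ((p.1 : G), p.2)‖ ^ 2 ≤ ‖v‖ ^ 2 := by
  have := lp.sum_rpow_le_norm_rpow (p := 2) (by norm_num) v (X ×ˢ Finset.univ)
  rw [Finset.sum_product] at this
  rw [Fintype.sum_prod_type, Finset.sum_coe_sort X (fun x => ∑ j, ‖v (x, j)‖ ^ 2)]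
  simpa using this

lemma l2_norm_sq {G : Type*} {d : ℕ} (v : L2 G d) : ‖v‖ ^ 2 = ∑' p, ‖v p‖ ^ 2 := by
  have := lp.norm_rpow_eq_tsum (p := 2) (by norm_num) v
  simpa using this

lemma l2_sum_eq {G : Type*} {d : ℕ} (v : L2 G d) (X : Finset G)
    (hv : ∀ z ∉ X, ∀ j, v (z, j) = 0) :
    ∑ p : ↥X × Fin d, ‖v ((p.1 : G), p.2)‖ ^ 2 = ‖v‖ ^ 2 := by
  rw [l2_norm_sq, tsum_eq_sum (s := X ×ˢ Finset.univ), Finset.sum_product,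
    Fintype.sum_prod_type, Finset.sum_coe_sort X (fun x => ∑ j, ‖v (x, j)‖ ^ 2)]
  rintro ⟨z, j⟩ hz
  rw [hv z (by simpa using hz)]; simp

lemma selfadj_unit {E : Type*} [NormedAddCommGroup E] [InnerProductSpace ℂ E] [CompleteSpace E]
    (A : E →L[ℂ] E) (hA : IsSelfAdjoint A) (lam : ℂ) (ε : ℝ) (hε : 0 < ε)
    (h : ∀ f, ε * ‖f‖ ≤ ‖A f - lam • f‖) : lam ∉ spectrum ℂ A := by
  rw [spectrum.notMem_iff]
  set N : E →L[ℂ] E := algebraMap ℂ (E →L[ℂ] E) lam - A with hN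
  have hNf : ∀ f, ε * ‖f‖ ≤ ‖N f‖ := fun f => by
    have : N f = -(A f - lam • f) := by simp [hN, Algebra.algebraMap_eq_smul_one]
    rw [this, norm_neg]; exact h f
  have hn : IsStarNormal N := by
    refine ⟨?_⟩
    have : star N = algebraMap ℂ (E →L[ℂ] E) (star lam) - A := by
      rw [hN, star_sub, hA.star_eq, ← algebraMap_star_comm]
    rw [this, hN]
    refine Commute.sub_left (Commute.sub_right ?_ ?_) (Commute.sub_right ?_ ?_)
    · exact Algebra.commutes _ _
    · exact Algebra.commutes _ _
    · exact (Algebra.commutes _ _).symm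
    · exact Commute.refl _
  rw [ContinuousLinearMap.isUnit_iff_bijective,
    ContinuousLinearMap.bijective_iff_dense_range_and_antilipschitz]
  constructor
  · rw [Submodule.topologicalClosure_eq_top_iff, ContinuousLinearMap.IsStarNormal.orthogonal_range hn, eq_bot_iff]
    intro f hf
    have := hNf f
    rw [show N f = 0 from hf, norm_zero] at this
    have : ‖f‖ ≤ 0 := by
      by_contra h'; push Not at h'; nlinarith [mul_pos hε h']
    simpa using this
  · refine ⟨Real.toNNReal ε⁻¹, ?_⟩
    refine AddMonoidHomClass.antilipschitz_of_bound N fun f => ?_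
    have := hNf f
    rw [Real.coe_toNNReal _ (by positivity), inv_mul_eq_div, le_div_iff₀ hε]; linarith

lemma exists_big {G : Type*} (X : ℕ → Finset G) (hmono : Monotone X)
    (hexh : ∀ g : G, ∃ i, g ∈ X i) (F : Finset G) : ∃ i, F ⊆ X i := by
  choose n hn using hexh
  refine ⟨F.sup n, fun g hg => ?_⟩
  exact hmono (Finset.le_sup hg) (hn g)

lemma part1 {G : Type*} [Group G]
    (X : ℕ → Finset G) (hmono : Monotone X) (hexh : ∀ g : G, ∃ i, g ∈ X i)
    (d : ℕ) (B : G →₀ Matrix (Fin d) (Fin d) ℂ)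
    (T : L2 G d →L[ℂ] L2 G d) (hT : Represents B T) :
    spectrum ℂ (ContinuousLinearMap.adjoint T ∘L T) ⊆
      closure (⋃ i : ℕ, spectrum ℂ (cutA B (X i))) := by
  intro lam hlam
  by_contra hcl
  rw [Metric.mem_closure_iff] at hcl
  push Not at hcl
  obtain ⟨ε, hε, hcl⟩ := hcl
  refine selfadj_unit _ ?_ lam ε hε ?_ hlam
  · exact IsSelfAdjoint.star_mul_self T
  set A := ContinuousLinearMap.adjoint T ∘L T with hA
  have fin : ∀ (s : Finset (G × Fin d)) (f : L2 G d), (∀ p ∉ s, f p = 0) →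
      ε * ‖f‖ ≤ ‖A f - lam • f‖ := by
    intro s f hf
    obtain ⟨i, hi⟩ := exists_big X hmono hexh
      (s.image Prod.fst ∪ B.support * s.image Prod.fst)
    have hs : ∀ z ∉ s.image Prod.fst, ∀ j, f (z, j) = 0 := fun z hz j =>
      hf _ fun h => hz (Finset.mem_image_of_mem Prod.fst h)
    have h1 := cutA_mulVec B T hT (X i) f (by
      intro z hz j
      by_contra h0
      have hzs : z ∈ s.image Prod.fst := by
        by_contra h; exact h0 (hs z h j)
      rcases Finset.mem_union.1 hz with hz | hz
      · obtain ⟨g, hg, x, hx, rfl⟩ := Finset.mem_mul.1 hz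
        refine (Finset.mem_sdiff.1 hx).2 (hi (Finset.mem_union_right _ ?_))
        have := Finset.mul_mem_mul (Finset.mem_inv'.1 hg) hzs
        simpa using this
      · exact (Finset.mem_sdiff.1 hz).2 (hi (Finset.mem_union_left _ hzs)))
    have h2 := hermitian_bound (cutA B (X i)) (Matrix.isHermitian_conjTranspose_mul_self _)
      lam ε hε.le (fun μ hμ => by
        have := hcl μ (Set.mem_iUnion.2 ⟨i, hμ⟩)
        rwa [dist_comm, dist_eq_norm] at this) (fun p => f ((p.1 : G), p.2))
    rw [h1, l2_sum_eq f (X i)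
      (fun z hz j => hs z (fun h => hz (hi (Finset.mem_union_left _ h))) j)] at h2
    have h3 := l2_sum_le (A f - lam • f) (X i)
    have h4 : (ε * ‖f‖) ^ 2 ≤ ‖A f - lam • f‖ ^ 2 := by
      rw [mul_pow]; exact h2.trans h3
    exact le_of_sq_le_sq h4 (norm_nonneg _)
  intro f
  have hsum := lp.hasSum_single (p := 2) (by norm_num) f
  refine le_of_tendsto_of_tendsto' (b := Filter.atTop)
    (f := fun s : Finset (G × Fin d) => ε * ‖∑ p ∈ s, lp.single 2 p (f p)‖)
    (g := fun s : Finset (G × Fin d) => ‖A (∑ p ∈ s, lp.single 2 p (f p)) -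
      lam • (∑ p ∈ s, lp.single 2 p (f p))‖) ?_ ?_ ?_
  · exact (hsum.norm).const_mul _
  · exact (((A.continuous.tendsto _).comp hsum).sub (Filter.Tendsto.const_smul hsum lam)).norm
  · intro s
    refine fin s _ fun p hp => ?_
    rw [lp.coeFn_sum, Finset.sum_apply]
    refine Finset.sum_eq_zero fun q hq => ?_
    rw [lp.single_apply_ne]
    rintro rfl; exact hp hq

lemma folner_all {G : Type*} [Group G] (S : Finset G)
    (hgen : Subgroup.closure (S : Set G) = ⊤) (X : ℕ → Finset G)
    (hfolner : Filter.Tendsto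
      (fun i => ((((S : Set G) * (X i : Set G)) \ (X i : Set G)).ncard : ℝ) /
        ((X i).card : ℝ)) Filter.atTop (nhds 0)) (g : G) :
    Filter.Tendsto (fun i => (((g • X i) \ X i).card : ℝ) / ((X i).card : ℝ))
      Filter.atTop (nhds 0) := by
  have hg : g ∈ Subgroup.closure (S : Set G) := by rw [hgen]; trivial
  induction hg using Subgroup.closure_induction with
  | mem s hs =>
    refine squeeze_zero (fun i => by positivity) (fun i => ?_) hfolner
    gcongr
    rw [← Finset.coe_mul, ← Finset.coe_sdiff, Set.ncard_coe_finset]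
    refine Finset.card_le_card (Finset.sdiff_subset_sdiff ?_ subset_rfl)
    exact Finset.smul_finset_subset_mul hs
  | one => simp
  | mul a b _ _ ha hb =>
    have := ha.add hb
    rw [add_zero] at this
    refine squeeze_zero (fun i => by positivity) (fun i => ?_) this
    rw [← add_div]
    gcongr
    norm_cast
    have h1 : ((a * b) • X i) \ X i ⊆ ((a • X i) \ X i) ∪ a • ((b • X i) \ X i) := by
      intro z hz
      rw [Finset.mem_sdiff, mul_smul] at hz
      rw [Finset.smul_finset_sdiff, Finset.mem_union, Finset.mem_sdiff, Finset.mem_sdiff]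
      tauto
    refine (Finset.card_le_card h1).trans ((Finset.card_union_le _ _).trans ?_)
    rw [Finset.card_smul_finset]
  | inv a _ ha =>
    refine ha.congr fun i => ?_
    congr 2
    rw [← Finset.card_smul_finset a ((a⁻¹ • X i) \ X i), Finset.smul_finset_sdiff, smul_inv_smul]
    exact Finset.card_sdiff_comm (Finset.card_smul_finset _ _)

lemma card_mul_sdiff_le {G : Type*} [Group G] (K X : Finset G) :
    ((K * X) \ X).card ≤ ∑ g ∈ K, ((g • X) \ X).card := by
  have : (K * X) \ X ⊆ K.biUnion fun g => (g • X) \ X := by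
    intro z hz
    obtain ⟨hz, hx⟩ := Finset.mem_sdiff.1 hz
    obtain ⟨g, hg, x, hxX, rfl⟩ := Finset.mem_mul.1 hz
    exact Finset.mem_biUnion.2 ⟨g, hg, Finset.mem_sdiff.2
      ⟨Finset.smul_mem_smul_finset hxX, hx⟩⟩
  exact (Finset.card_le_card this).trans Finset.card_biUnion_le

lemma folner_collar {G : Type*} [Group G] (S : Finset G)
    (hgen : Subgroup.closure (S : Set G) = ⊤) (X : ℕ → Finset G)
    (hfolner : Filter.Tendsto
      (fun i => ((((S : Set G) * (X i : Set G)) \ (X i : Set G)).ncard : ℝ) /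
        ((X i).card : ℝ)) Filter.atTop (nhds 0)) (K : Finset G) :
    Filter.Tendsto (fun i => ((collar K (X i)).card : ℝ) / ((X i).card : ℝ))
      Filter.atTop (nhds 0) := by
  have hsum : ∀ L : Finset G, Filter.Tendsto
      (fun i => ∑ g ∈ L, (((g • X i) \ X i).card : ℝ) / ((X i).card : ℝ))
      Filter.atTop (nhds 0) := fun L => by
    simpa using tendsto_finset_sum L (fun g _ => folner_all S hgen X hfolner g)
  have := ((hsum K).const_mul (K.card : ℝ)).add (hsum K⁻¹)
  rw [mul_zero, add_zero] at this
  refine squeeze_zero (fun i => by positivity) (fun i => ?_) this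
  rw [← Finset.sum_div, ← Finset.sum_div, ← mul_div_assoc, ← add_div]
  gcongr
  norm_cast
  refine (Finset.card_union_le _ _).trans (add_le_add ?_ (card_mul_sdiff_le _ _))
  refine Finset.card_mul_le.trans ?_
  rw [Finset.card_inv]
  exact Nat.mul_le_mul_left _ (card_mul_sdiff_le _ _)

lemma l2_eval {G : Type*} {d : ℕ} (v : L2 G d) (p : G × Fin d) :
    v p = ⟪lp.single 2 p (1 : ℂ), v⟫_ℂ := by
  rw [lp.inner_single_left]; simp

lemma dim_bound {G : Type*} {d : ℕ} (V : Submodule ℂ (L2 G d))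
    (hV : IsClosed (V : Set (L2 G d))) (C X : Finset G)
    (hCX : ∀ v ∈ V, (∀ z ∈ C, ∀ j, v (z, j) = 0) → ∀ z ∈ X, ∀ j, v (z, j) = 0)
    (j : Fin d) (c R : ℝ) (hc : 0 ≤ c)
    (hf : ∀ x ∈ X, ∃ v ∈ V, ‖v‖ = R ∧ ‖v (x, j)‖ = c) :
    c ^ 2 * X.card ≤ R ^ 2 * (C.card * d) := by
  let ev : L2 G d →ₗ[ℂ] (↥C × Fin d → ℂ) :=
    { toFun := fun v p => v ((p.1 : G), p.2)
      map_add' := fun _ _ => rfl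
      map_smul' := fun _ _ => rfl }
  let VC : Submodule ℂ (L2 G d) := V ⊓ LinearMap.ker ev
  have hVC : IsClosed (VC : Set (L2 G d)) := by
    have : (VC : Set (L2 G d)) = (V : Set (L2 G d)) ∩
        ⋂ p : ↥C × Fin d, {v | ⟪lp.single 2 (((p.1 : G), p.2) : G × Fin d) (1 : ℂ), v⟫_ℂ = 0} := by
      ext v
      simp only [VC, Submodule.coe_inf, Set.mem_inter_iff, SetLike.mem_coe, LinearMap.mem_ker,
        Set.mem_iInter, Set.mem_setOf_eq, ← l2_eval]
      refine and_congr_right fun _ => ?_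
      exact funext_iff
    rw [this]
    refine hV.inter (isClosed_iInter fun p => isClosed_eq (by fun_prop) continuous_const)
  haveI : CompleteSpace VC := hVC.completeSpace_coe
  let W : Submodule ℂ (L2 G d) := V ⊓ VCᗮ
  let evW : W →ₗ[ℂ] (↥C × Fin d → ℂ) := ev ∘ₗ W.subtype
  have hinj : Function.Injective evW := by
    rw [← LinearMap.ker_eq_bot, eq_bot_iff]
    rintro ⟨w, hw⟩ hw0
    have hw1 : w ∈ VC := ⟨hw.1, hw0⟩
    have : ⟪w, w⟫_ℂ = 0 := hw.2 w hw1
    simpa using this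
  haveI : FiniteDimensional ℂ W := FiniteDimensional.of_injective evW hinj
  have hdim : Module.finrank ℂ W ≤ C.card * d := by
    have := LinearMap.finrank_le_finrank_of_injective hinj
    simpa using this
  let b := stdOrthonormalBasis ℂ W
  have hpt : ∀ x ∈ X, c ^ 2 ≤ R ^ 2 * ∑ k, ‖(b k : L2 G d) (x, j)‖ ^ 2 := by
    intro x hx
    obtain ⟨v, hv, hvR, hvc⟩ := hf x hx
    let v' : L2 G d := VC.starProjection v
    have hv' : v' ∈ VC := Submodule.starProjection_apply_mem _ _
    have hwW : v - v' ∈ W :=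
      ⟨V.sub_mem hv hv'.1, Submodule.sub_starProjection_mem_orthogonal v⟩
    let w : W := ⟨v - v', hwW⟩
    have hwn : ‖w‖ ≤ R := by
      have h1 : ‖v‖ * ‖v‖ = ‖v'‖ * ‖v'‖ + ‖v - v'‖ * ‖v - v'‖ := by
        have := norm_add_sq_eq_norm_sq_add_norm_sq_of_inner_eq_zero (𝕜 := ℂ) v' (v - v')
          (hwW.2 v' hv')
        rwa [add_sub_cancel] at this
      have h2 : ‖w‖ = ‖v - v'‖ := rfl
      rw [h2, ← hvR]
      nlinarith [norm_nonneg (v - v'), norm_nonneg v, mul_self_nonneg ‖v'‖]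
    have hw0 : ‖(w : L2 G d) (x, j)‖ = c := by
      have h0 : v' (x, j) = 0 := by
        refine hCX v' hv'.1 (fun z hz j => ?_) x hx j
        exact congrFun (show ev v' = 0 from hv'.2) (⟨z, hz⟩, j)
      rw [← hvc]
      change ‖v (x, j) - v' (x, j)‖ = _
      rw [h0, sub_zero]
    have hexp : (w : L2 G d) (x, j) = ∑ k, ⟪b k, w⟫_ℂ * (b k : L2 G d) (x, j) := by
      conv_lhs => rw [← b.sum_repr' w]
      rw [l2_eval, Submodule.coe_sum, inner_sum]
      refine Finset.sum_congr rfl fun k _ => ?_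
      rw [Submodule.coe_smul, inner_smul_right, ← l2_eval]
    have hle : c ≤ ∑ k, ‖⟪b k, w⟫_ℂ‖ * ‖(b k : L2 G d) (x, j)‖ := by
      rw [← hw0, hexp]
      refine (norm_sum_le _ _).trans (le_of_eq ?_)
      simp only [norm_mul]
    calc c ^ 2 ≤ (∑ k, ‖⟪b k, w⟫_ℂ‖ * ‖(b k : L2 G d) (x, j)‖) ^ 2 := by gcongr
      _ ≤ (∑ k, ‖⟪b k, w⟫_ℂ‖ ^ 2) * ∑ k, ‖(b k : L2 G d) (x, j)‖ ^ 2 :=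
        Finset.sum_mul_sq_le_sq_mul_sq _ _ _
      _ = ‖w‖ ^ 2 * ∑ k, ‖(b k : L2 G d) (x, j)‖ ^ 2 := by rw [b.sum_sq_norm_inner_right]
      _ ≤ _ := by gcongr
  have hb : ∀ k, ∑ x ∈ X, ‖(b k : L2 G d) (x, j)‖ ^ 2 ≤ 1 := by
    intro k
    have := lp.sum_rpow_le_norm_rpow (p := 2) (by norm_num) (b k : L2 G d) (X ×ˢ {j})
    rw [Finset.sum_product] at this
    have hn : ‖(b k : L2 G d)‖ = 1 := b.orthonormal.1 k
    rw [hn] at this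
    simpa using this
  calc c ^ 2 * X.card = ∑ x ∈ X, c ^ 2 := by simp [mul_comm]
    _ ≤ ∑ x ∈ X, R ^ 2 * ∑ k, ‖(b k : L2 G d) (x, j)‖ ^ 2 := Finset.sum_le_sum hpt
    _ = R ^ 2 * ∑ k, ∑ x ∈ X, ‖(b k : L2 G d) (x, j)‖ ^ 2 := by
      rw [← Finset.mul_sum, Finset.sum_comm]
    _ ≤ R ^ 2 * ∑ k : Fin (Module.finrank ℂ W), 1 := by
      gcongr with k; exact hb k
    _ ≤ R ^ 2 * (C.card * d) := by
      gcongr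
      simp only [Finset.sum_const, Finset.card_univ, Fintype.card_fin, nsmul_eq_mul, mul_one]
      exact_mod_cast hdim

lemma exists_translate {G : Type*} [Group G] {d : ℕ} (f : L2 G d) (a : G) :
    ∃ h : L2 G d, (∀ y j, h (y, j) = f (y * a, j)) ∧ ‖h‖ = ‖f‖ := by
  let e : G × Fin d ≃ G × Fin d := (Equiv.mulRight a).prodCongr (Equiv.refl _)
  have hm : Memℓp (fun p => f (e p)) 2 := by
    have := (memℓp_gen_iff (p := 2) (by norm_num)).1 f.2
    refine (memℓp_gen_iff (by norm_num)).2 ?_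
    exact e.summable_iff.2 this
  refine ⟨⟨_, hm⟩, fun y j => rfl, ?_⟩
  have h1 : ‖(⟨_, hm⟩ : L2 G d)‖ ^ 2 = ‖f‖ ^ 2 := by
    rw [l2_norm_sq, l2_norm_sq]
    exact e.tsum_eq (fun p => ‖f p‖ ^ 2)
  exact (pow_left_inj₀ (norm_nonneg _) (norm_nonneg _) two_ne_zero).1 h1

lemma part2 {G : Type*} [Group G] (S : Finset G)
    (hgen : Subgroup.closure (S : Set G) = ⊤)
    (X : ℕ → Finset G) (hmono : Monotone X) (hexh : ∀ g : G, ∃ i, g ∈ X i)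
    (hfolner : Filter.Tendsto
      (fun i => ((((S : Set G) * (X i : Set G)) \ (X i : Set G)).ncard : ℝ) /
        ((X i).card : ℝ)) Filter.atTop (nhds 0))
    (d : ℕ) (B : G →₀ Matrix (Fin d) (Fin d) ℂ)
    (T : L2 G d →L[ℂ] L2 G d) (hT : Represents B T) (lam : ℂ) (f : L2 G d) (hf : f ≠ 0)
    (hlam : (ContinuousLinearMap.adjoint T ∘L T) f = lam • f) :
    lam ∈ ⋃ i : ℕ, spectrum ℂ (cutA B (X i)) := by
  by_contra hnot
  set A := ContinuousLinearMap.adjoint T ∘L T with hA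
  let V : Submodule ℂ (L2 G d) := LinearMap.ker (A - lam • ContinuousLinearMap.id ℂ (L2 G d)).toLinearMap
  have hVmem : ∀ v, v ∈ V ↔ A v = lam • v := fun v => by
    simp [V, sub_eq_zero]
  have hVc : IsClosed (V : Set (L2 G d)) := ContinuousLinearMap.isClosed_ker _
  obtain ⟨⟨x0, j⟩, hx0⟩ : ∃ p, f p ≠ 0 := by
    by_contra h; push Not at h
    exact hf (lp.ext (funext h))
  have hAtr : ∀ (h : L2 G d) (a : G), (∀ y j, h (y, j) = f (y * a, j)) → h ∈ V := by
    intro h a hh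
    rw [hVmem]
    have hTT : ∀ y j, T h (y, j) = T f (y * a, j) := by
      intro y j
      rw [hT, hT]; simp only [hh, mul_assoc]
    ext ⟨y, j⟩
    have h2 : A h (y, j) = A f (y * a, j) := by
      rw [hA, ContinuousLinearMap.comp_apply, ContinuousLinearMap.comp_apply,
        adj_apply B T hT, adj_apply B T hT]
      simp only [hTT, mul_assoc]
    rw [h2, hlam]
    change lam * f (y * a, j) = lam * h (y, j)
    rw [hh]
  have key : ∀ i, ‖f (x0, j)‖ ^ 2 * (X i).card ≤
      ‖f‖ ^ 2 * ((collar B.support (X i)).card * d) := by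
    intro i
    refine dim_bound V hVc _ _ ?_ j _ _ (norm_nonneg _) ?_
    · intro v hv hvC z hz k
      by_contra hne
      refine hnot (Set.mem_iUnion.2 ⟨i, ?_⟩)
      have h1 := cutA_mulVec B T hT (X i) v hvC
      rw [← hA, (hVmem v).1 hv] at h1
      rw [← Matrix.spectrum_toLin', ← Module.End.hasEigenvalue_iff_mem_spectrum]
      refine Module.End.hasEigenvalue_of_hasEigenvector
        (x := fun p : ↥(X i) × Fin d => v ((p.1 : G), p.2)) ⟨?_, ?_⟩
      · rw [Module.End.mem_eigenspace_iff, Matrix.toLin'_apply, h1]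
        rfl
      · intro h0
        exact hne (congrFun h0 (⟨z, hz⟩, k))
    · intro x _
      obtain ⟨h, hh, hn⟩ := exists_translate f (x⁻¹ * x0)
      refine ⟨h, hAtr h _ hh, hn, ?_⟩
      rw [hh]; simp
  have hpos : 0 < ‖f (x0, j)‖ ^ 2 := by positivity
  have hlim := (folner_collar S hgen X hfolner B.support).const_mul (‖f‖ ^ 2 * d)
  rw [mul_zero] at hlim
  have hev := hlim.eventually (gt_mem_nhds hpos)
  obtain ⟨n, hn⟩ := hexh 1
  obtain ⟨i, hi, hni⟩ := (hev.and (Filter.eventually_ge_atTop n)).exists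
  have hcard : 0 < ((X i).card : ℝ) := by
    exact_mod_cast Finset.card_pos.2 ⟨1, hmono hni hn⟩
  have := key i
  rw [← mul_div_assoc, div_lt_iff₀ hcard] at hi
  linarith

end helpers

/-- Let `G` be a finitely generated amenable group with a Følner
exhaustion `X₁ ⊆ X₂ ⊆ ⋯ ⊆ G`, let `B ∈ M_d(ℂG)` act on `ℓ²(G; ℂ^d)` (via the operator
`T`), and let `A := B*B`.  Then the spectrum of `A` is contained in the closure of
`⋃ i spec(A[i])`, where `A[i] = B[i]* B[i]` and `B[i] = P_i B P_i*`, and every eigenvalue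
of `A` lies in `⋃ i spec(A[i])`. -/
theorem amenable_spectrum_approximation
    (G : Type*) [Group G]
    (S : Finset G) (hsymm : ∀ s ∈ S, s⁻¹ ∈ S)
    (hgen : Subgroup.closure (S : Set G) = ⊤)
    (X : ℕ → Finset G) (hmono : Monotone X) (hexh : ∀ g : G, ∃ i, g ∈ X i)
    (hfolner : Filter.Tendsto
      (fun i => ((((S : Set G) * (X i : Set G)) \ (X i : Set G)).ncard : ℝ) /
        ((X i).card : ℝ)) Filter.atTop (nhds 0))
    (d : ℕ) (hd : 1 ≤ d)
    (B : G →₀ Matrix (Fin d) (Fin d) ℂ)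
    (T : L2 G d →L[ℂ] L2 G d) (hT : Represents B T) :
    spectrum ℂ (ContinuousLinearMap.adjoint T ∘L T) ⊆
      closure (⋃ i : ℕ, spectrum ℂ (cutA B (X i))) ∧
    ∀ (lam : ℂ) (f : L2 G d), f ≠ 0 →
      (ContinuousLinearMap.adjoint T ∘L T) f = lam • f →
      lam ∈ ⋃ i : ℕ, spectrum ℂ (cutA B (X i)) := by
  exact ⟨part1 X hmono hexh d B T hT, fun lam f hf h =>
    part2 S hgen X hmono hexh hfolner d B T hT lam f hf h⟩

end
end
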